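/- Let γ ∈ (0,1/2). Assume the density of ν_γ with respect to Lebesgue measure is bounded by V(γ) x^{−γ} for some constant V(γ) > 0. Let f be positive and nonincreasing on (0,1) with f(x) ≤ C x^{−a} for some constant C > 0 and some a with 0 ≤ a < 1/2 − γ. Then ν_γ(f > t) ≤ (C^{(1−γ)/a} V(γ)/(1−γ)) t^{−(1−γ)/a} for all t > 0 (when a > 0), and n^{−1/2} S_n(f − ν_γ(f)) converges in distribution, on ([0,1], ν_γ), to a centered Gaussian law. -/

import Mathlib

open MeasureTheory ProbabilityTheory Filter Set
open scoped ENNReal NNReal Topology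

noncomputable section

/-- The intermittent (Liverani–Saussol–Vaienti) map `T_γ` on `[0,1]`. -/
def Tmap (γ : ℝ) (x : ℝ) : ℝ :=
  if x < 1/2 then x * (1 + 2 ^ γ * x ^ γ) else 2 * x - 1

/-- `K` is the Perron–Frobenius operator of `T_γ` with respect to `ν`:
`ν(f · g∘T_γ) = ν(K f · g)` for all bounded measurable `f, g`. -/
def IsPFOp (γ : ℝ) (ν : Measure ℝ) (K : (ℝ → ℝ) → ℝ → ℝ) : Prop :=
  ∀ f g : ℝ → ℝ, Measurable f → Measurable g → (∃ C, ∀ x, |f x| ≤ C) →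
    (∃ C, ∀ x, |g x| ≤ C) →
    ∫ x, f x * g (Tmap γ x) ∂ν = ∫ x, (K f) x * g x ∂ν

/-- Birkhoff sums `S_n(f) = ∑_{i=1}^n f ∘ T_γ^i`. -/
def Sn (γ : ℝ) (f : ℝ → ℝ) (n : ℕ) (x : ℝ) : ℝ :=
  ∑ i ∈ Finset.range n, f ((Tmap γ)^[i + 1] x)

/-- The class `H_{α,1}` of `α`-Hölder functions (with constant 1) on `[0,1]`. -/
def Hclass (α : ℝ) : Set (ℝ → ℝ) :=
  {f | ∀ x ∈ Set.Icc (0:ℝ) 1, ∀ y ∈ Set.Icc (0:ℝ) 1, |f x - f y| ≤ |x - y| ^ α}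

/-- `f_t = 1_{(-∞, t]}`. -/
def indic (t : ℝ) : ℝ → ℝ := Set.indicator (Set.Iic t) (fun _ => 1)

/-- Nested operator `K^{(n_1,…,n_k)}(f_1,…,f_k)
= K^{n_1}(f_1 · K^{n_2}(f_2 ⋯ K^{n_k}(f_k)⋯))`, encoded by a list of pairs. -/
def nestedK (K : (ℝ → ℝ) → ℝ → ℝ) : List (ℕ × (ℝ → ℝ)) → ℝ → ℝ
  | [] => fun _ => 1
  | (n, f) :: r => K^[n] (fun x => f x * nestedK K r x)

/-- The list `[(n, f_{t_1}), (n_2, f_{t_2}), …, (n_l, f_{t_l})]`. -/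
def tList (n : ℕ) {l : ℕ} (ns : Fin l → ℕ) (ts : Fin (l + 1) → ℝ) :
    List (ℕ × (ℝ → ℝ)) :=
  (n, indic (ts 0)) :: List.ofFn (fun i : Fin l => (ns i, indic (ts i.succ)))

/-- The coefficient `α_1(n)` for an operator `K` with invariant measure `ν`. -/
def alpha1 (K : (ℝ → ℝ) → ℝ → ℝ) (ν : Measure ℝ) (n : ℕ) : ℝ :=
  ⨆ t : ℝ, ∫ x, |K^[n] (indic t) x - ∫ y, indic t y ∂ν| ∂ν

/-- The dependence coefficient `α_k(n)`. -/
def alphaCoef (K : (ℝ → ℝ) → ℝ → ℝ) (ν : Measure ℝ) (k n : ℕ) : ℝ :=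
  max (alpha1 K ν n)
    (⨆ j : Fin (k - 1), ⨆ ns : {m : Fin (j.1 + 1) → ℕ // ∀ i, 1 ≤ m i},
      ⨆ ts : Fin (j.1 + 2) → ℝ,
        ∫ x, |nestedK K (tList n ns.1 ts) x - ∫ y, nestedK K (tList n ns.1 ts) y ∂ν| ∂ν)

/-- The dependence coefficient `β_1(n)`. -/
def beta1 (K : (ℝ → ℝ) → ℝ → ℝ) (ν : Measure ℝ) (n : ℕ) : ℝ :=
  ∫ x, (⨆ t : ℝ, |K^[n] (indic t) x - ∫ y, indic t y ∂ν|) ∂ν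

/-- The dependence coefficient `β_k(n)`. -/
def betaCoef (K : (ℝ → ℝ) → ℝ → ℝ) (ν : Measure ℝ) (k n : ℕ) : ℝ :=
  max (beta1 K ν n)
    (⨆ j : Fin (k - 1), ⨆ ns : {m : Fin (j.1 + 1) → ℕ // ∀ i, 1 ≤ m i},
      ∫ x, (⨆ ts : Fin (j.1 + 2) → ℝ,
        |nestedK K (tList n ns.1 ts) x - ∫ y, nestedK K (tList n ns.1 ts) y ∂ν|) ∂ν)

/-- The operator associated with a Markov transition kernel: `(Kg)(x) = ∫ g(y) K(x,dy)`. -/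
def Kop (K : Kernel ℝ ℝ) (g : ℝ → ℝ) : ℝ → ℝ := fun x => ∫ y, g y ∂(K x)

/-- The class `Mon(M,p,μ)` of monotonic functions on an open interval, vanishing
elsewhere, with tail condition `μ(|g|>t) ≤ M^p t^{-p}` (for `p < ∞`),
resp. `μ(|g|>M) = 0` (for `p = ∞`). -/
def Mon (M : ℝ) (p : ℝ≥0∞) (μ : Measure ℝ) (g : ℝ → ℝ) : Prop :=
  (∃ I : Set ℝ, IsOpen I ∧ I.OrdConnected ∧ (MonotoneOn g I ∨ AntitoneOn g I) ∧
      ∀ x ∉ I, g x = 0) ∧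
  (if p = ∞ then μ {x | M < |g x|} = 0
   else ∀ t : ℝ, 0 < t →
      μ {x | t < |g x|} ≤ ENNReal.ofReal (M ^ p.toReal * t ^ (-p.toReal)))

/-- The class `C(M,p,μ)`: the closure in `L¹(μ)` of convex-type combinations
`∑ a_i g_i`, `∑ |a_i| ≤ 1`, `g_i ∈ Mon(M,p,μ)`. -/
def ClassC (M : ℝ) (p : ℝ≥0∞) (μ : Measure ℝ) (f : ℝ → ℝ) : Prop :=
  Integrable f μ ∧ ∀ ε : ℝ, 0 < ε → ∃ (n : ℕ) (a : Fin n → ℝ) (g : Fin n → ℝ → ℝ),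
    (∑ i, |a i|) ≤ 1 ∧ (∀ i, Mon M p μ (g i)) ∧
    ∫ x, |f x - ∑ i, a i * g i x| ∂μ < ε

/-- The class `Lip_c` of functions `g` with `|g(x) − g(y)| ≤ c(|x−y|)`. -/
def LipC (c : ℝ → ℝ) : Set (ℝ → ℝ) := {g | ∀ x y : ℝ, |g x - g y| ≤ c |x - y|}

/-- The distance `d_c(P,Q) = sup_{g ∈ Lip_c} |P(g) − Q(g)|`. -/
def dC (c : ℝ → ℝ) (P Q : Measure ℝ) : ℝ :=
  ⨆ g : LipC c, |(∫ x, (g : ℝ → ℝ) x ∂P) - ∫ x, (g : ℝ → ℝ) x ∂Q|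

/-! ### Birkhoff averages and the mean ergodic property -/

section MeanErgodic

variable {Ω : Type*} [MeasurableSpace Ω] {μ : Measure Ω} {T : Ω → Ω}

/-- The Birkhoff averages of `φ` converge in `L¹(μ)` to the mean of `φ`. -/
def MeanErgodic (μ : Measure Ω) (T : Ω → Ω) (φ : Ω → ℝ) : Prop :=
  Tendsto (fun n : ℕ => ∫ x, |(n : ℝ)⁻¹ * birkhoffSum T φ n x - ∫ y, φ y ∂μ| ∂μ) atTop (𝓝 0)

lemma integrable_birkhoffSum (hT : MeasurePreserving T μ μ) {φ : Ω → ℝ} (hφ : Integrable φ μ)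
    (n : ℕ) : Integrable (birkhoffSum T φ n) μ := by
  unfold birkhoffSum
  exact integrable_finsetSum _ fun i _ => (hT.iterate i).integrable_comp_of_integrable hφ

lemma measurable_birkhoffSum (hT : Measurable T) {φ : Ω → ℝ} (hφ : Measurable φ) (n : ℕ) :
    Measurable (birkhoffSum T φ n) := by
  unfold birkhoffSum
  exact Finset.measurable_fun_sum _ fun i _ => hφ.comp (hT.iterate i)

lemma integral_comp_of_measurePreserving (hT : MeasurePreserving T μ μ) {E : Type*}
    [NormedAddCommGroup E] [NormedSpace ℝ E] {φ : Ω → E} (hφ : AEStronglyMeasurable φ μ) :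
    ∫ x, φ (T x) ∂μ = ∫ x, φ x ∂μ := by
  conv_rhs => rw [← hT.map_eq]
  rw [integral_map hT.measurable.aemeasurable (by rwa [hT.map_eq])]

lemma integral_birkhoffSum (hT : MeasurePreserving T μ μ) {φ : Ω → ℝ} (hφ : Integrable φ μ)
    (n : ℕ) : ∫ x, birkhoffSum T φ n x ∂μ = n * ∫ x, φ x ∂μ := by
  unfold birkhoffSum
  rw [integral_finsetSum _ fun i _ => by
    simpa using! (hT.iterate i).integrable_comp_of_integrable hφ]
  simp [integral_comp_of_measurePreserving (hT.iterate _) hφ.aestronglyMeasurable]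

lemma integral_abs_birkhoffSum_le (hT : MeasurePreserving T μ μ) {φ : Ω → ℝ}
    (hφ : Integrable φ μ) (n : ℕ) :
    ∫ x, |birkhoffSum T φ n x| ∂μ ≤ n * ∫ x, |φ x| ∂μ := by
  rw [← integral_birkhoffSum hT hφ.abs n]
  refine integral_mono (integrable_birkhoffSum hT hφ n).abs
    (integrable_birkhoffSum hT hφ.abs n) fun x => ?_
  exact Finset.abs_sum_le_sum_abs _ _

lemma birkhoffSum_sub_fun {Ω : Type*} {T : Ω → Ω} (φ ψ : Ω → ℝ) (n : ℕ) (x : Ω) :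
    birkhoffSum T (fun y => φ y - ψ y) n x = birkhoffSum T φ n x - birkhoffSum T ψ n x := by
  simp [birkhoffSum, Finset.sum_sub_distrib]

lemma MeanErgodic.const_mul {φ : Ω → ℝ} (h : MeanErgodic μ T φ) (c : ℝ) :
    MeanErgodic μ T (fun x => c * φ x) := by
  have h2 := Tendsto.const_mul |c| h
  rw [mul_zero] at h2
  refine h2.congr fun n => ?_
  rw [← integral_const_mul]
  refine integral_congr_ae (ae_of_all _ fun x => ?_)
  simp only
  rw [← abs_mul, integral_const_mul]
  congr 1
  simp only [birkhoffSum, ← Finset.mul_sum]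
  ring

variable [IsProbabilityMeasure μ]

lemma MeanErgodic.of_approx (hT : MeasurePreserving T μ μ) {φ : Ω → ℝ} (hφ : Integrable φ μ)
    (h : ∀ ε > 0, ∃ ψ, Integrable ψ μ ∧ MeanErgodic μ T ψ ∧ ∫ x, |φ x - ψ x| ∂μ ≤ ε) :
    MeanErgodic μ T φ := by
  rw [MeanErgodic, Metric.tendsto_atTop]
  intro ε hε
  obtain ⟨ψ, hψ, hψT, hφψ⟩ := h (ε / 4) (by positivity)
  obtain ⟨N, hN⟩ := Metric.tendsto_atTop.1 hψT (ε / 4) (by positivity)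
  refine ⟨N, fun n hn => ?_⟩
  have h1 := hN n hn
  have hd : Integrable (fun x => φ x - ψ x) μ := hφ.sub hψ
  rw [Real.dist_eq, sub_zero, abs_of_nonneg (integral_nonneg fun x => abs_nonneg _)] at h1 ⊢
  have hA : ∀ {χ : Ω → ℝ}, Integrable χ μ →
      Integrable (fun x => |(n : ℝ)⁻¹ * birkhoffSum T χ n x - ∫ y, χ y ∂μ|) μ := fun hχ =>
    (((integrable_birkhoffSum hT hχ n).const_mul _).sub (integrable_const _)).abs
  have hB : Integrable (fun x => (n : ℝ)⁻¹ * |birkhoffSum T (fun y => φ y - ψ y) n x|) μ :=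
    (integrable_birkhoffSum hT hd n).abs.const_mul _
  have h2 : |∫ y, φ y ∂μ - ∫ y, ψ y ∂μ| ≤ ε / 4 := by
    rw [← integral_sub hφ hψ]
    exact (abs_integral_le_integral_abs).trans hφψ
  have h3 : ∫ x, (n : ℝ)⁻¹ * |birkhoffSum T (fun y => φ y - ψ y) n x| ∂μ ≤ ε / 4 := by
    rw [integral_const_mul]
    have := integral_abs_birkhoffSum_le hT hd n
    rcases Nat.eq_zero_or_pos n with rfl | hn0
    · simp; positivity
    · have hn' : (0 : ℝ) < n := by exact_mod_cast hn0
      rw [inv_mul_le_iff₀ hn']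
      exact this.trans (by gcongr)
  calc ∫ x, |(n : ℝ)⁻¹ * birkhoffSum T φ n x - ∫ y, φ y ∂μ| ∂μ
      ≤ ∫ x, (|(n : ℝ)⁻¹ * birkhoffSum T ψ n x - ∫ y, ψ y ∂μ|
          + (n : ℝ)⁻¹ * |birkhoffSum T (fun y => φ y - ψ y) n x| + ε / 4) ∂μ := by
        refine integral_mono (hA hφ) (((hA hψ).add hB).add (integrable_const _)) fun x => ?_
        have hn' : (0 : ℝ) ≤ (n : ℝ)⁻¹ := by positivity
        have e : (n : ℝ)⁻¹ * birkhoffSum T φ n x - ∫ y, φ y ∂μ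
          = ((n : ℝ)⁻¹ * birkhoffSum T ψ n x - ∫ y, ψ y ∂μ)
            + (n : ℝ)⁻¹ * birkhoffSum T (fun y => φ y - ψ y) n x
            + (∫ y, ψ y ∂μ - ∫ y, φ y ∂μ) := by
          rw [birkhoffSum_sub_fun]; ring
        have a1 := abs_add_three ((n : ℝ)⁻¹ * birkhoffSum T ψ n x - ∫ y, ψ y ∂μ)
          ((n : ℝ)⁻¹ * birkhoffSum T (fun y => φ y - ψ y) n x) (∫ y, ψ y ∂μ - ∫ y, φ y ∂μ)
        rw [abs_mul, abs_of_nonneg hn', abs_sub_comm (∫ y, ψ y ∂μ)] at a1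
        simp only [e]
        linarith
    _ < ε := by
        rw [integral_add (by simpa using! (hA hψ).add hB) (integrable_const _),
          integral_add (hA hψ) hB]
        simp
        linarith

lemma MeanErgodic.add (hT : MeasurePreserving T μ μ) {φ ψ : Ω → ℝ} (hφ : Integrable φ μ)
    (hψ : Integrable ψ μ) (h : MeanErgodic μ T φ) (h' : MeanErgodic μ T ψ) :
    MeanErgodic μ T (fun x => φ x + ψ x) := by
  have h2 := Tendsto.add h h'
  rw [add_zero] at h2
  refine squeeze_zero (fun n => integral_nonneg fun x => abs_nonneg _) (fun n => ?_) h2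
  have hA : ∀ {χ : Ω → ℝ}, Integrable χ μ →
      Integrable (fun x => |(n : ℝ)⁻¹ * birkhoffSum T χ n x - ∫ y, χ y ∂μ|) μ := fun hχ =>
    (((integrable_birkhoffSum hT hχ n).const_mul _).sub (integrable_const _)).abs
  rw [← integral_add (hA hφ) (hA hψ)]
  refine integral_mono (hA (hφ.add hψ)) ((hA hφ).add (hA hψ)) fun x => ?_
  have e : birkhoffSum T (fun x => φ x + ψ x) n x = birkhoffSum T φ n x + birkhoffSum T ψ n x := by
    simp [birkhoffSum, Finset.sum_add_distrib]
  simp only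
  rw [e, integral_add hφ hψ]
  refine le_trans (le_of_eq ?_) (abs_add_le _ _)
  congr 1; ring

lemma MeanErgodic.const (c : ℝ) : MeanErgodic μ T (fun _ => c) := by
  refine tendsto_const_nhds.congr' ?_
  filter_upwards [eventually_gt_atTop 0] with n hn
  have : (n : ℝ) ≠ 0 := by exact_mod_cast hn.ne'
  simp [birkhoffSum, this]

lemma MeanErgodic.of_ae_eq (hT : MeasurePreserving T μ μ) {φ ψ : Ω → ℝ} (hψ : Integrable ψ μ)
    (h : φ =ᵐ[μ] ψ) (hφ : MeanErgodic μ T φ) : MeanErgodic μ T ψ := by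
  refine MeanErgodic.of_approx hT hψ fun ε hε => ⟨φ, hψ.congr h.symm, hφ, ?_⟩
  rw [integral_congr_ae (g := fun _ => (0 : ℝ))]
  · simpa using hε.le
  · filter_upwards [h] with x hx
    simp [hx]

/-- The mean ergodic property for a generating `π`-system of sets gives it for all
integrable functions. -/
lemma meanErgodic_of_isPiSystem {Ω : Type*} [hm : MeasurableSpace Ω] {μ : Measure Ω}
    [IsProbabilityMeasure μ] {T : Ω → Ω} (hT : MeasurePreserving T μ μ) {s : Set (Set Ω)}
    (hs : hm = MeasurableSpace.generateFrom s) (hpi : IsPiSystem s)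
    (h : ∀ A ∈ s, MeanErgodic μ T (A.indicator fun _ => 1))
    {φ : Ω → ℝ} (hφ : Integrable φ μ) : MeanErgodic μ T φ := by
  have hset : ∀ A, MeasurableSet A → MeanErgodic μ T (A.indicator fun _ => 1) := by
    intro A hA
    induction A, hA using MeasurableSpace.induction_on_inter hs hpi with
    | empty => simpa using MeanErgodic.const (μ := μ) (T := T) 0
    | basic A hA => exact h A hA
    | compl A hA ih =>
      have i1 : Integrable (fun x => (-1 : ℝ) * A.indicator (fun _ => 1) x) μ :=
        ((integrable_const 1).indicator hA).const_mul _
      have := MeanErgodic.add hT (integrable_const 1) i1 (MeanErgodic.const 1) (ih.const_mul (-1))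
      convert this using 1
      ext x
      by_cases hx : x ∈ A <;> simp [hx]
    | iUnion A hd hA ih =>
      have hfin : ∀ n : ℕ, MeanErgodic μ T
          (fun x => ∑ i ∈ Finset.range n, (A i).indicator (fun _ => (1 : ℝ)) x) := by
        intro n
        induction n with
        | zero => simpa using MeanErgodic.const (μ := μ) (T := T) 0
        | succ n ihn =>
          simp only [Finset.sum_range_succ]
          exact MeanErgodic.add hT
            (integrable_finsetSum _ fun i _ => (integrable_const 1).indicator (hA i))
            ((integrable_const 1).indicator (hA n)) ihn (ih n)
      refine MeanErgodic.of_approx hT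
        ((integrable_const 1).indicator (MeasurableSet.iUnion hA)) fun ε hε => ?_
      have hsum : ∀ x, HasSum (fun i => (A i).indicator (fun _ => (1 : ℝ)) x)
          ((⋃ i, A i).indicator (fun _ => (1 : ℝ)) x) := by
        intro x
        by_cases hx : x ∈ ⋃ i, A i
        · obtain ⟨i, hi⟩ := mem_iUnion.1 hx
          have : ∀ j, j ≠ i → (A j).indicator (fun _ => (1 : ℝ)) x = 0 := fun j hj =>
            indicator_of_notMem (fun hj' => (hd hj).le_bot ⟨hj', hi⟩) _
          convert hasSum_single i this using 1
          simp [hx, hi]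
        · have : ∀ i, x ∉ A i := by simpa using hx
          simp [hx, this]
      have hle : ∀ n x, |(⋃ i, A i).indicator (fun _ => (1 : ℝ)) x
          - ∑ i ∈ Finset.range n, (A i).indicator (fun _ => (1 : ℝ)) x| ≤ 1 := by
        intro n x
        have nn : ∀ i, 0 ≤ (A i).indicator (fun _ => (1 : ℝ)) x := fun i =>
          indicator_nonneg (fun _ _ => zero_le_one) _
        have := sum_le_hasSum (Finset.range n) (fun i _ => nn i) (hsum x)
        have h2 := Finset.sum_nonneg (s := Finset.range n) fun i _ => nn i
        rw [abs_of_nonneg (by linarith)]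
        have : (⋃ i, A i).indicator (fun _ => (1 : ℝ)) x ≤ 1 :=
          indicator_le_self' (f := fun _ => (1 : ℝ)) (fun _ _ => zero_le_one) x
        linarith
      have mU : Measurable ((⋃ i, A i).indicator (fun _ => (1 : ℝ))) :=
        measurable_const.indicator (MeasurableSet.iUnion hA)
      have mS : ∀ n, Measurable
          (fun x => ∑ i ∈ Finset.range n, (A i).indicator (fun _ => (1 : ℝ)) x) := fun n =>
        Finset.measurable_fun_sum _ fun i _ => measurable_const.indicator (hA i)
      have hlim : Tendsto (fun n : ℕ => ∫ x, |(⋃ i, A i).indicator (fun _ => (1 : ℝ)) x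
          - ∑ i ∈ Finset.range n, (A i).indicator (fun _ => (1 : ℝ)) x| ∂μ) atTop
          (𝓝 (∫ _, (0 : ℝ) ∂μ)) := by
        refine tendsto_integral_of_dominated_convergence (fun _ => 1)
          (fun n => ((mU.sub (mS n)).abs).aestronglyMeasurable) (integrable_const 1)
          (fun n => ae_of_all _ fun x => ?_) (ae_of_all _ fun x => ?_)
        · rw [Real.norm_eq_abs, abs_abs]; exact hle n x
        · have := ((hsum x).tendsto_sum_nat.const_sub
            ((⋃ i, A i).indicator (fun _ => (1 : ℝ)) x)).abs
          simpa using this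
      rw [integral_zero] at hlim
      obtain ⟨n, hn⟩ := (hlim.eventually_le_const hε).exists
      exact ⟨_, integrable_finsetSum _ fun i _ => (integrable_const 1).indicator (hA i), hfin n, hn⟩
  refine Integrable.induction (P := fun φ => MeanErgodic μ T φ) ?_ ?_ ?_ ?_ hφ
  · intro c A hA _
    convert (hset A hA).const_mul c using 1
    ext x
    by_cases hx : x ∈ A <;> simp [hx]
  · intro f g _ hf hg h1 h2
    exact h1.add hT hf hg h2
  · refine IsSeqClosed.isClosed fun u f hu hf => ?_
    refine MeanErgodic.of_approx hT (L1.integrable_coeFn f) fun ε hε => ?_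
    obtain ⟨N, hN⟩ := Metric.tendsto_atTop.1 hf ε hε
    refine ⟨u N, L1.integrable_coeFn _, hu N, ?_⟩
    have := hN N le_rfl
    rw [dist_comm, dist_eq_norm, L1.norm_eq_integral_norm] at this
    refine le_trans (le_of_eq (integral_congr_ae ?_)) this.le
    filter_upwards [Lp.coeFn_sub f (u N)] with x hx
    rw [hx]; simp
  · intro f g hfg hf hPf
    exact hPf.of_ae_eq hT (hf.congr hfg) hfg

end MeanErgodic

/-! ### Central limit theorem for reversed martingale differences -/

section MartingaleCLT

variable {Ω : Type*} [mΩ : MeasurableSpace Ω] {μ : Measure Ω} {T : Ω → Ω}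

/-- `m` is a reversed martingale difference for `T`: it is integrable and its conditional
expectation given `T⁻¹` of the whole `σ`-algebra vanishes. -/
structure IsReversedDiff (μ : Measure Ω) (T : Ω → Ω) (m : Ω → ℝ) : Prop where
  integrable : Integrable m μ
  setIntegral_preimage : ∀ A, MeasurableSet A → ∫ x in T ⁻¹' A, m x ∂μ = 0

variable {m : Ω → ℝ}

lemma memLp_birkhoffSum (hT : MeasurePreserving T μ μ) (h2 : MemLp m 2 μ) (n : ℕ) :
    MemLp (birkhoffSum T m n) 2 μ := by
  unfold birkhoffSum
  exact memLp_finsetSum _ fun i _ => h2.comp_measurePreserving (hT.iterate i)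

variable [IsProbabilityMeasure μ]

lemma IsReversedDiff.condExp_ae_eq_zero (hT : Measurable T) (h : IsReversedDiff μ T m) :
    μ[m | mΩ.comap T] =ᵐ[μ] 0 := by
  refine (ae_eq_condExp_of_forall_setIntegral_eq hT.comap_le h.integrable
    (fun s _ _ => (integrable_zero _ _ _).integrableOn) ?_
    aestronglyMeasurable_zero).symm
  rintro s ⟨A, hA, rfl⟩ _
  simp [h.setIntegral_preimage A hA]

lemma IsReversedDiff.integral_mul_comp_eq_zero (hT : Measurable T) (h : IsReversedDiff μ T m)
    {φ : Ω → ℝ} (hφ : Measurable φ) (hi : Integrable (fun x => m x * φ (T x)) μ) :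
    ∫ x, m x * φ (T x) ∂μ = 0 := by
  have h1 : μ[m * (φ ∘ T) | mΩ.comap T] =ᵐ[μ] μ[m | mΩ.comap T] * (φ ∘ T) :=
    condExp_mul_of_stronglyMeasurable_right
      (hφ.comp (comap_measurable T)).stronglyMeasurable hi h.integrable
  have h2 : ∫ x, (m * (φ ∘ T)) x ∂μ = 0 := by
    rw [← integral_condExp hT.comap_le, integral_congr_ae (g := fun _ => (0 : ℝ))]
    · simp
    · filter_upwards [h1, h.condExp_ae_eq_zero hT] with x hx hx'
      rw [hx, Pi.mul_apply, hx']; simp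
  simpa using h2

lemma IsReversedDiff.integral_birkhoffSum_sq (hT : MeasurePreserving T μ μ)
    (h : IsReversedDiff μ T m) (hm : Measurable m) (h2 : MemLp m 2 μ) (n : ℕ) :
    ∫ x, birkhoffSum T m n x ^ 2 ∂μ = n * ∫ x, m x ^ 2 ∂μ := by
  induction n with
  | zero => simp
  | succ n ih =>
    have hS := memLp_birkhoffSum hT h2 n
    have hST : MemLp (fun x => birkhoffSum T m n (T x)) 2 μ := hS.comp_measurePreserving hT
    have i1 : Integrable (fun x => m x * birkhoffSum T m n (T x)) μ := h2.integrable_mul hST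
    have e : ∀ x, birkhoffSum T m (n + 1) x ^ 2 = m x ^ 2
        + 2 * (m x * birkhoffSum T m n (T x)) + birkhoffSum T m n (T x) ^ 2 := by
      intro x; rw [birkhoffSum_succ']; ring
    simp only [e]
    rw [integral_add (by simpa using! h2.integrable_sq.add (i1.const_mul 2)) hST.integrable_sq,
      integral_add h2.integrable_sq (i1.const_mul 2), integral_const_mul,
      h.integral_mul_comp_eq_zero hT.measurable (measurable_birkhoffSum hT.measurable hm n) i1,
      integral_comp_of_measurePreserving hT (φ := fun x => birkhoffSum T m n x ^ 2)
        hS.integrable_sq.aestronglyMeasurable, ih]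
    push_cast; ring

lemma IsReversedDiff.integral_mul_comp_complex (hT : Measurable T) (h : IsReversedDiff μ T m)
    {φ : Ω → ℂ} (hφ : Measurable φ) {C : ℝ} (hC : ∀ x, ‖φ x‖ ≤ C) :
    ∫ x, (m x : ℂ) * φ (T x) ∂μ = 0 := by
  have hb : ∀ {ψ : Ω → ℝ}, Measurable ψ → (∀ x, |ψ x| ≤ C) →
      Integrable (fun x => m x * ψ (T x)) μ := fun hψ hψC =>
    h.integrable.mul_bdd (hψ.comp hT).aestronglyMeasurable (ae_of_all _ fun x => hψC _)
  have hre := hb (Complex.measurable_re.comp hφ) fun x => (Complex.abs_re_le_norm _).trans (hC x)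
  have him := hb (Complex.measurable_im.comp hφ) fun x => (Complex.abs_im_le_norm _).trans (hC x)
  have hi : Integrable (fun x => (m x : ℂ) * φ (T x)) μ :=
    h.integrable.ofReal.mul_bdd (hφ.comp hT).aestronglyMeasurable (ae_of_all _ fun x => hC _)
  apply Complex.ext
  · have := integral_re hi
    simp only [RCLike.re_to_complex] at this
    rw [← this]
    simpa using! h.integral_mul_comp_eq_zero hT (Complex.measurable_re.comp hφ) hre
  · have := integral_im hi
    simp only [RCLike.im_to_complex] at this
    rw [← this]
    simpa using! h.integral_mul_comp_eq_zero hT (Complex.measurable_im.comp hφ) him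

lemma norm_one_add_mul_I_le (y : ℝ) : ‖(1 : ℂ) + y * Complex.I‖ ≤ Real.exp (y ^ 2 / 2) := by
  have h1 : ‖(1 : ℂ) + y * Complex.I‖ ^ 2 = 1 + y ^ 2 := by
    rw [← Complex.normSq_eq_norm_sq, Complex.normSq_apply]; simp; ring
  have h2 : Real.exp (y ^ 2 / 2) ^ 2 = Real.exp (y ^ 2) := by
    rw [← Real.exp_nat_mul]; congr 1; push_cast; ring
  refine le_of_sq_le_sq ?_ (Real.exp_pos _).le
  rw [h1, h2]
  linarith [Real.add_one_le_exp (y ^ 2)]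

lemma norm_exp_sub_one_add_mul_I_le {y : ℝ} (hy : |y| ≤ 1) :
    ‖Complex.exp (y * Complex.I + y ^ 2 / 2) - (1 + y * Complex.I)‖ ≤ 30 * |y| ^ 3 := by
  set z : ℂ := y * Complex.I + y ^ 2 / 2 with hz
  have hy0 := abs_nonneg y
  have hzn : ‖z‖ ≤ 3 / 2 * |y| := by
    refine (norm_add_le _ _).trans ?_
    have : ‖(y : ℂ) * Complex.I‖ = |y| := by simp
    have h2 : ‖(y : ℂ) ^ 2 / 2‖ = |y| ^ 2 / 2 := by simp
    rw [this, h2]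
    nlinarith
  have h3 := Complex.norm_exp_sub_sum_le_norm_mul_exp z 3
  have hs : ∑ j ∈ Finset.range 3, z ^ j / (j.factorial : ℂ) = 1 + z + z ^ 2 / 2 := by
    simp [Finset.sum_range_succ]
  rw [hs] at h3
  have e : Complex.exp z - (1 + y * Complex.I)
      = (Complex.exp z - (1 + z + z ^ 2 / 2)) + (Complex.I * y ^ 3 / 2 + y ^ 4 / 8) := by
    have hI : Complex.I ^ 2 = -1 := Complex.I_sq
    rw [hz]; ring_nf; rw [hI]; ring
  rw [e]
  refine (norm_add_le _ _).trans ?_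
  have h4 : ‖Complex.I * (y : ℂ) ^ 3 / 2 + (y : ℂ) ^ 4 / 8‖ ≤ |y| ^ 3 := by
    refine (norm_add_le _ _).trans ?_
    have a1 : ‖Complex.I * (y : ℂ) ^ 3 / 2‖ = |y| ^ 3 / 2 := by simp
    have a2 : ‖(y : ℂ) ^ 4 / 8‖ = |y| ^ 4 / 8 := by simp
    rw [a1, a2]
    have : |y| ^ 4 ≤ |y| ^ 3 := pow_le_pow_of_le_one hy0 hy (by norm_num)
    have := pow_nonneg hy0 3
    linarith
  have h5 : Real.exp ‖z‖ ≤ 8 := by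
    have : ‖z‖ ≤ 2 := by linarith
    calc Real.exp ‖z‖ ≤ Real.exp 2 := Real.exp_le_exp.2 this
      _ = Real.exp 1 ^ 2 := by rw [← Real.exp_nat_mul]; norm_num
      _ ≤ 2.7182818286 ^ 2 := by gcongr; exact Real.exp_one_lt_d9.le
      _ ≤ 8 := by norm_num
  have h6 : ‖z‖ ^ 3 * Real.exp ‖z‖ ≤ (3 / 2 * |y|) ^ 3 * 8 := by gcongr
  nlinarith [pow_nonneg hy0 3]

lemma norm_prod_sub_prod_le {a b : ℕ → ℂ} {K δ : ℝ} (hK : 1 ≤ K) (ha : ∀ i, ‖a i‖ ≤ K)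
    (hb : ∀ i, ‖b i‖ ≤ K) (hab : ∀ i, ‖a i - b i‖ ≤ δ) (n : ℕ) :
    ‖∏ i ∈ Finset.range n, a i - ∏ i ∈ Finset.range n, b i‖ ≤ n * δ * K ^ n := by
  have hδ : 0 ≤ δ := (norm_nonneg _).trans (hab 0)
  induction n with
  | zero => simp
  | succ n ih =>
    rw [Finset.prod_range_succ, Finset.prod_range_succ]
    have e : (∏ i ∈ Finset.range n, a i) * a n - (∏ i ∈ Finset.range n, b i) * b n
      = (∏ i ∈ Finset.range n, a i - ∏ i ∈ Finset.range n, b i) * a n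
        + (∏ i ∈ Finset.range n, b i) * (a n - b n) := by ring
    have hp : ‖∏ i ∈ Finset.range n, b i‖ ≤ K ^ n := by
      rw [norm_prod]
      refine (Finset.prod_le_prod (fun i _ => norm_nonneg _) fun i _ => hb i).trans ?_
      simp
    have hKn : K ^ n ≤ K ^ (n + 1) := pow_le_pow_right₀ hK (Nat.le_succ n)
    have hKn0 : 0 ≤ K ^ n := by positivity
    calc _ ≤ ‖∏ i ∈ Finset.range n, a i - ∏ i ∈ Finset.range n, b i‖ * ‖a n‖
          + ‖∏ i ∈ Finset.range n, b i‖ * ‖a n - b n‖ := by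
          rw [e, ← norm_mul, ← norm_mul]; exact norm_add_le _ _
      _ ≤ (n * δ * K ^ n) * K + K ^ n * δ := by
          gcongr
          · exact ha n
          · exact hab n
      _ ≤ (n * δ * K ^ n) * K + K ^ (n + 1) * δ := by gcongr
      _ = _ := by push_cast; ring

lemma IsReversedDiff.integral_prod_eq_one (hT : MeasurePreserving T μ μ)
    (h : IsReversedDiff μ T m) (hm : Measurable m) {M : ℝ} (hM : ∀ x, |m x| ≤ M) (s : ℝ) (n : ℕ) :
    ∫ x, ∏ i ∈ Finset.range n, (1 + ((s * m (T^[i] x) : ℝ) : ℂ) * Complex.I) ∂μ = 1 := by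
  have hmeas : ∀ n, Measurable fun x =>
      ∏ i ∈ Finset.range n, (1 + ((s * m (T^[i] x) : ℝ) : ℂ) * Complex.I) := by
    intro n
    refine Finset.measurable_fun_prod _ fun i _ => ?_
    have hmi : Measurable fun x => m (T^[i] x) := hm.comp (hT.measurable.iterate i)
    exact measurable_const.add
      ((Complex.measurable_ofReal.comp (hmi.const_mul s)).mul_const Complex.I)
  have hbd : ∀ n x, ‖∏ i ∈ Finset.range n, (1 + ((s * m (T^[i] x) : ℝ) : ℂ) * Complex.I)‖
      ≤ (1 + |s| * M) ^ n := by
    intro n x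
    rw [norm_prod]
    refine (Finset.prod_le_prod (g := fun _ => 1 + |s| * M) (fun i _ => norm_nonneg _)
      fun i _ => ?_).trans_eq (by simp)
    refine (norm_add_le _ _).trans ?_
    simp only [norm_one, norm_mul, Complex.norm_I, mul_one, Complex.norm_real,
      Real.norm_eq_abs]
    gcongr
    exact hM _
  induction n with
  | zero => simp
  | succ n ih =>
    set Φ : Ω → ℂ := fun x =>
      ∏ i ∈ Finset.range n, (1 + ((s * m (T^[i] x) : ℝ) : ℂ) * Complex.I) with hΦ
    have e : ∀ x, ∏ i ∈ Finset.range (n + 1), (1 + ((s * m (T^[i] x) : ℝ) : ℂ) * Complex.I)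
        = Φ (T x) + (s * Complex.I) * ((m x : ℂ) * Φ (T x)) := by
      intro x
      rw [Finset.prod_range_succ']
      simp only [hΦ, Function.iterate_succ_apply, Function.iterate_zero, id]
      push_cast; ring
    have iΦ : Integrable (fun x => Φ (T x)) μ :=
      Integrable.of_bound ((hmeas n).comp hT.measurable).aestronglyMeasurable _
        (ae_of_all _ fun x => hbd n _)
    have iΦ2 : Integrable (fun x => (m x : ℂ) * Φ (T x)) μ :=
      h.integrable.ofReal.mul_bdd ((hmeas n).comp hT.measurable).aestronglyMeasurable
        (ae_of_all _ fun x => hbd n _)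
    simp only [e]
    rw [integral_add iΦ (iΦ2.const_mul _), integral_const_mul,
      h.integral_mul_comp_complex hT.measurable (hmeas n) (hbd n), mul_zero, add_zero,
      integral_comp_of_measurePreserving hT (hmeas n).aestronglyMeasurable, ih]

end MartingaleCLT

section MartingaleCLT

lemma norm_exp_sum_sub_prod_le {y : ℕ → ℝ} {b : ℝ} (hb : b ≤ 1) (hy : ∀ i, |y i| ≤ b) (n : ℕ) :
    ‖Complex.exp ((∑ i ∈ Finset.range n, y i : ℝ) * Complex.I
        + ((∑ i ∈ Finset.range n, y i ^ 2) / 2 : ℝ))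
      - ∏ i ∈ Finset.range n, (1 + (y i : ℂ) * Complex.I)‖
      ≤ n * (30 * b ^ 3) * Real.exp (b ^ 2 / 2) ^ n := by
  have e : Complex.exp ((∑ i ∈ Finset.range n, y i : ℝ) * Complex.I
        + ((∑ i ∈ Finset.range n, y i ^ 2) / 2 : ℝ))
      = ∏ i ∈ Finset.range n, Complex.exp (y i * Complex.I + (y i : ℂ) ^ 2 / 2) := by
    rw [← Complex.exp_sum]
    congr 1
    push_cast
    rw [Finset.sum_add_distrib, Finset.sum_mul, Finset.sum_div]
  have hsq : ∀ i, y i ^ 2 ≤ b ^ 2 := fun i => by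
    rw [← sq_abs]
    exact pow_le_pow_left₀ (abs_nonneg _) (hy i) 2
  rw [e]
  refine norm_prod_sub_prod_le (Real.one_le_exp (by positivity)) (fun i => ?_) (fun i => ?_)
    (fun i => ?_) n
  · rw [Complex.norm_exp]
    refine Real.exp_le_exp.2 ?_
    have : (y i * Complex.I + (y i : ℂ) ^ 2 / 2).re = y i ^ 2 / 2 := by
      have : (y i * Complex.I + (y i : ℂ) ^ 2 / 2) = (y i ^ 2 / 2 : ℝ) + y i * Complex.I := by
        push_cast; ring
      rw [this]; simp [-Complex.ofReal_div, -Complex.ofReal_pow]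
    rw [this]
    linarith [hsq i]
  · refine (norm_one_add_mul_I_le _).trans (Real.exp_le_exp.2 ?_)
    linarith [hsq i]
  · refine (norm_exp_sub_one_add_mul_I_le ((hy i).trans hb)).trans ?_
    gcongr
    exact hy i

lemma abs_exp_sub_exp_le {a b c : ℝ} (ha : a ≤ c) (hb : b ≤ c) :
    |Real.exp a - Real.exp b| ≤ Real.exp c * |a - b| := by
  wlog h : b ≤ a generalizing a b
  · rw [abs_sub_comm, abs_sub_comm a]
    exact this hb ha (le_of_not_ge h)
  rw [abs_of_nonneg (by linarith [Real.exp_le_exp.2 h]), abs_of_nonneg (by linarith)]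
  have h1 : Real.exp a - Real.exp b = Real.exp a * (1 - Real.exp (b - a)) := by
    rw [mul_sub, ← Real.exp_add]; ring_nf
  have h2 := Real.add_one_le_exp (b - a)
  rw [h1]
  exact mul_le_mul (Real.exp_le_exp.2 ha) (by linarith)
    (by linarith [Real.exp_le_one_iff.2 (show b - a ≤ 0 by linarith)]) (Real.exp_pos _).le

variable {Ω : Type*} [mΩ : MeasurableSpace Ω] {μ : Measure Ω} {T : Ω → Ω}
  [IsProbabilityMeasure μ] {m : Ω → ℝ}

lemma IsReversedDiff.norm_charFun_sub_one_le (hT : MeasurePreserving T μ μ)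
    (h : IsReversedDiff μ T m) (hm : Measurable m) {M : ℝ} (hM : ∀ x, |m x| ≤ M)
    {s : ℝ} (hs : |s| * M ≤ 1) {n : ℕ} (hn : 0 < n) :
    ‖Complex.exp ((n * s ^ 2 * (∫ x, m x ^ 2 ∂μ) / 2 : ℝ))
        * (∫ x, Complex.exp ((s * birkhoffSum T m n x : ℝ) * Complex.I) ∂μ) - 1‖
      ≤ n * (30 * (|s| * M) ^ 3) * Real.exp ((|s| * M) ^ 2 / 2) ^ n
        + Real.exp (n * s ^ 2 * M ^ 2 / 2) * (n * s ^ 2 / 2)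
          * ∫ x, |(n : ℝ)⁻¹ * birkhoffSum T (fun y => m y ^ 2) n x - ∫ y, m y ^ 2 ∂μ| ∂μ := by
  set σ := ∫ x, m x ^ 2 ∂μ with hσ
  set Q := birkhoffSum T (fun y => m y ^ 2) n with hQ
  have hn' : (0 : ℝ) < n := by exact_mod_cast hn
  have hm2M : ∀ x, m x ^ 2 ≤ M ^ 2 := fun x => by
    rw [← sq_abs]; exact pow_le_pow_left₀ (abs_nonneg _) (hM x) 2
  have hm2i : Integrable (fun x => m x ^ 2) μ :=
    Integrable.of_bound (hm.pow_const 2).aestronglyMeasurable (M ^ 2)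
      (ae_of_all _ fun x => by rw [Real.norm_eq_abs, abs_of_nonneg (sq_nonneg _)]; exact hm2M x)
  have hσM : σ ≤ M ^ 2 := by
    have := integral_mono hm2i (integrable_const (M ^ 2)) hm2M
    simpa using this
  have hQM : ∀ x, Q x ≤ n * M ^ 2 := fun x => by
    refine (Finset.sum_le_sum fun i _ => hm2M _).trans_eq ?_
    simp
  have hSm := measurable_birkhoffSum hT.measurable hm n
  have hQm : Measurable Q := measurable_birkhoffSum hT.measurable (hm.pow_const 2) n
  have hQi : Integrable Q μ := integrable_birkhoffSum hT hm2i n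
  set P : Ω → ℂ := fun x =>
    ∏ i ∈ Finset.range n, (1 + ((s * m (T^[i] x) : ℝ) : ℂ) * Complex.I) with hP
  set E : Ω → ℂ := fun x => Complex.exp ((s * birkhoffSum T m n x : ℝ) * Complex.I) with hE
  have hEm : Measurable E := Complex.measurable_exp.comp
    ((Complex.measurable_ofReal.comp (hSm.const_mul s)).mul_const _)
  have hEn : ∀ x, ‖E x‖ = 1 := fun x => Complex.norm_exp_ofReal_mul_I _
  have hEi : Integrable E μ := Integrable.of_bound hEm.aestronglyMeasurable 1
    (ae_of_all _ fun x => (hEn x).le)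
  have hPm : Measurable P := by
    refine Finset.measurable_fun_prod _ fun i _ => ?_
    have hmi : Measurable fun x => m (T^[i] x) := hm.comp (hT.measurable.iterate i)
    exact measurable_const.add
      ((Complex.measurable_ofReal.comp (hmi.const_mul s)).mul_const Complex.I)
  have key : ∀ x, ‖Complex.exp ((n * s ^ 2 * σ / 2 : ℝ)) * E x - P x‖
      ≤ n * (30 * (|s| * M) ^ 3) * Real.exp ((|s| * M) ^ 2 / 2) ^ n
        + Real.exp (n * s ^ 2 * M ^ 2 / 2) * (n * s ^ 2 / 2) * |(n : ℝ)⁻¹ * Q x - σ| := by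
    intro x
    have h1 := norm_exp_sum_sub_prod_le (y := fun i => s * m (T^[i] x)) hs
      (fun i => by rw [abs_mul]; gcongr; exact hM _) n
    have e1 : ∑ i ∈ Finset.range n, s * m (T^[i] x) = s * birkhoffSum T m n x := by
      rw [← Finset.mul_sum]; rfl
    have e2 : ∑ i ∈ Finset.range n, (s * m (T^[i] x)) ^ 2 = s ^ 2 * Q x := by
      simp only [mul_pow]; rw [← Finset.mul_sum]; rfl
    simp only [e1, e2] at h1
    rw [Complex.exp_add] at h1
    change ‖E x * _ - P x‖ ≤ _ at h1
    have h2 : ‖Complex.exp ((n * s ^ 2 * σ / 2 : ℝ)) * E x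
        - E x * Complex.exp ((s ^ 2 * Q x / 2 : ℝ))‖
        ≤ Real.exp (n * s ^ 2 * M ^ 2 / 2) * (n * s ^ 2 / 2) * |(n : ℝ)⁻¹ * Q x - σ| := by
      rw [mul_comm, ← mul_sub, norm_mul, hEn, one_mul, ← Complex.ofReal_exp, ← Complex.ofReal_exp,
        ← Complex.ofReal_sub, Complex.norm_real, Real.norm_eq_abs]
      refine (abs_exp_sub_exp_le (c := n * s ^ 2 * M ^ 2 / 2) (by gcongr) ?_).trans_eq ?_
      · have := mul_le_mul_of_nonneg_left (hQM x) (sq_nonneg s)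
        linarith
      · rw [mul_assoc (Real.exp _), abs_sub_comm]
        congr 1
        have hpos : 0 ≤ n * s ^ 2 / 2 := by positivity
        rw [← abs_of_nonneg hpos, ← abs_mul]
        congr 1
        field_simp
    calc _ = ‖(Complex.exp ((n * s ^ 2 * σ / 2 : ℝ)) * E x
            - E x * Complex.exp ((s ^ 2 * Q x / 2 : ℝ)))
            + (E x * Complex.exp ((s ^ 2 * Q x / 2 : ℝ)) - P x)‖ := by congr 1; ring
      _ ≤ _ := (norm_add_le _ _).trans (by linarith)
  have hPb : Integrable P μ := by
    refine Integrable.of_bound hPm.aestronglyMeasurable ((1 + |s| * M) ^ n)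
      (ae_of_all _ fun x => ?_)
    rw [hP, norm_prod]
    refine (Finset.prod_le_prod (g := fun _ => 1 + |s| * M) (fun i _ => norm_nonneg _)
      fun i _ => ?_).trans_eq (by simp)
    refine (norm_add_le _ _).trans ?_
    simp only [norm_one, norm_mul, Complex.norm_I, mul_one, Complex.norm_real, Real.norm_eq_abs]
    gcongr
    exact hM _
  rw [← h.integral_prod_eq_one hT hm hM s n, ← integral_const_mul,
    ← integral_sub (hEi.const_mul _) hPb]
  have hav : Integrable (fun x => |(n : ℝ)⁻¹ * Q x - σ|) μ := by
    simpa using! ((hQi.const_mul (n : ℝ)⁻¹).sub (integrable_const σ)).abs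
  refine (norm_integral_le_of_norm_le ((integrable_const _).add (hav.const_mul _))
    (ae_of_all _ key)).trans_eq ?_
  simp only [Pi.add_apply]
  rw [integral_add (integrable_const _) (hav.const_mul _)]
  simp [integral_const_mul]

lemma IsReversedDiff.tendsto_charFun_of_bounded (hT : MeasurePreserving T μ μ)
    (h : IsReversedDiff μ T m) (hm : Measurable m) {M : ℝ} (hM : ∀ x, |m x| ≤ M)
    (hE : MeanErgodic μ T fun x => m x ^ 2) (t : ℝ) :
    Tendsto (fun n : ℕ => ∫ x, Complex.exp
      ((t * ((√n)⁻¹ * birkhoffSum T m n x) : ℝ) * Complex.I) ∂μ) atTop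
      (𝓝 (Real.exp (-(t ^ 2 * (∫ x, m x ^ 2 ∂μ) / 2)) : ℝ)) := by
  set σ := ∫ x, m x ^ 2 ∂μ with hσ
  have hM0 : 0 ≤ M := by
    obtain ⟨x⟩ : Nonempty Ω := nonempty_of_isProbabilityMeasure μ
    exact (abs_nonneg _).trans (hM x)
  have hsq : Tendsto (fun n : ℕ => √(n : ℝ)) atTop atTop :=
    Real.tendsto_sqrt_atTop.comp tendsto_natCast_atTop_atTop
  have hinv : Tendsto (fun n : ℕ => (√(n : ℝ))⁻¹) atTop (𝓝 0) := tendsto_inv_atTop_zero.comp hsq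
  have hbound : Tendsto (fun n : ℕ => 30 * (|t| * M) ^ 3 * Real.exp (t ^ 2 * M ^ 2 / 2)
        * (√(n : ℝ))⁻¹ + Real.exp (t ^ 2 * M ^ 2 / 2) * (t ^ 2 / 2)
        * ∫ x, |(n : ℝ)⁻¹ * birkhoffSum T (fun y => m y ^ 2) n x - ∫ y, m y ^ 2 ∂μ| ∂μ)
      atTop (𝓝 0) := by
    simpa using! (hinv.const_mul (30 * (|t| * M) ^ 3 * Real.exp (t ^ 2 * M ^ 2 / 2))).add
      (Tendsto.const_mul (Real.exp (t ^ 2 * M ^ 2 / 2) * (t ^ 2 / 2)) hE)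
  have hlim : Tendsto (fun n : ℕ => (Real.exp (t ^ 2 * σ / 2) : ℂ) * ∫ x, Complex.exp
      ((t * ((√n)⁻¹ * birkhoffSum T m n x) : ℝ) * Complex.I) ∂μ) atTop (𝓝 1) := by
    rw [tendsto_iff_norm_sub_tendsto_zero]
    refine squeeze_zero' (Eventually.of_forall fun n => norm_nonneg _) ?_ hbound
    have hsmall : ∀ᶠ n : ℕ in atTop, |t| * M * (√(n : ℝ))⁻¹ < 1 := by
      have := hinv.const_mul (|t| * M)
      rw [mul_zero] at this
      exact this.eventually_lt_const one_pos
    filter_upwards [hsmall, eventually_gt_atTop 0] with n hn hn0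
    have hn' : (0 : ℝ) < n := by exact_mod_cast hn0
    have hr : 0 < √(n : ℝ) := Real.sqrt_pos.2 hn'
    have hrr : √(n : ℝ) ^ 2 = n := Real.sq_sqrt hn'.le
    set r := √(n : ℝ) with hrdef
    have habs : |t * r⁻¹| = |t| * r⁻¹ := by rw [abs_mul, abs_of_pos (inv_pos.2 hr)]
    have h1 := h.norm_charFun_sub_one_le hT hm hM (s := t * r⁻¹) (n := n)
      (by rw [habs]; linarith) hn0
    have a1 : (n : ℝ) * (t * r⁻¹) ^ 2 = t ^ 2 := by rw [← hrr]; field_simp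
    have a2 : (n : ℝ) * (30 * (|t * r⁻¹| * M) ^ 3) * Real.exp ((|t * r⁻¹| * M) ^ 2 / 2) ^ n
        = 30 * (|t| * M) ^ 3 * Real.exp (t ^ 2 * M ^ 2 / 2) * r⁻¹ := by
      have a3 : Real.exp ((|t * r⁻¹| * M) ^ 2 / 2) ^ n = Real.exp (t ^ 2 * M ^ 2 / 2) := by
        rw [← Real.exp_nat_mul, mul_pow |t * r⁻¹| M 2, sq_abs]
        congr 1
        linear_combination (M ^ 2 / 2) * a1
      rw [a3, habs, ← hrr]
      field_simp
    rw [a1, a2] at h1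
    simp only [mul_assoc t r⁻¹, Complex.ofReal_exp] at h1 ⊢
    exact h1
  have := hlim.const_mul ((Real.exp (-(t ^ 2 * σ / 2)) : ℝ) : ℂ)
  simp only [← mul_assoc, ← Complex.ofReal_mul, ← Real.exp_add, mul_one] at this
  simpa [mul_assoc] using this

end MartingaleCLT

section MartingaleCLT

variable {Ω : Type*} [mΩ : MeasurableSpace Ω] {μ : Measure Ω} {T : Ω → Ω}

lemma integral_sq_le_of_eLpNorm_le {φ : Ω → ℝ} (hφ : MemLp φ 2 μ) {δ : ℝ} (hδ : 0 ≤ δ)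
    (h : eLpNorm φ 2 μ ≤ ENNReal.ofReal δ) : ∫ x, φ x ^ 2 ∂μ ≤ δ ^ 2 := by
  rw [hφ.eLpNorm_eq_integral_rpow_norm (by norm_num) (by norm_num),
    ENNReal.ofReal_le_ofReal_iff hδ] at h
  have e : ∫ x, ‖φ x‖ ^ (2 : ℝ≥0∞).toReal ∂μ = ∫ x, φ x ^ 2 ∂μ := by
    simp
  rw [e] at h
  simp only [ENNReal.toReal_ofNat, ← one_div, ← Real.sqrt_eq_rpow] at h
  exact (Real.sqrt_le_left hδ).1 h

lemma IsReversedDiff.congr_ae {m m' : Ω → ℝ}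
    (h : IsReversedDiff μ T m) (hm : m =ᵐ[μ] m') : IsReversedDiff μ T m' := by
  refine ⟨h.integrable.congr hm, fun A hA => ?_⟩
  rw [← h.setIntegral_preimage A hA]
  exact integral_congr_ae (ae_restrict_of_ae hm.symm)

lemma IsReversedDiff.sub {m m' : Ω → ℝ} (h : IsReversedDiff μ T m) (h' : IsReversedDiff μ T m') :
    IsReversedDiff μ T (fun x => m x - m' x) := by
  refine ⟨h.integrable.sub h'.integrable, fun A hA => ?_⟩
  rw [integral_sub h.integrable.integrableOn h'.integrable.integrableOn,
    h.setIntegral_preimage A hA, h'.setIntegral_preimage A hA, sub_zero]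

lemma abs_integral_sq_sub_le {m m' : Ω → ℝ} (h2 : MemLp m 2 μ) (h2' : MemLp m' 2 μ) {δ : ℝ}
    (hδ : 0 < δ) (h : ∫ x, (m x - m' x) ^ 2 ∂μ ≤ δ ^ 2) :
    |∫ x, m' x ^ 2 ∂μ - ∫ x, m x ^ 2 ∂μ| ≤ δ ^ 2 + δ * ∫ x, m x ^ 2 ∂μ + δ := by
  have hd2 : Integrable (fun x => (m x - m' x) ^ 2) μ := (h2.sub h2').integrable_sq
  rw [← integral_sub h2'.integrable_sq h2.integrable_sq]
  refine abs_integral_le_integral_abs.trans ?_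
  have hb : ∀ x, |m' x ^ 2 - m x ^ 2| ≤ (1 + δ⁻¹) * (m x - m' x) ^ 2 + δ * m x ^ 2 := fun x => by
    have h1 : 0 ≤ δ⁻¹ * (m x - m' x + δ * m x) ^ 2 := by positivity
    have h3 : 0 ≤ δ⁻¹ * (m x - m' x - δ * m x) ^ 2 := by positivity
    have e1 : δ⁻¹ * (m x - m' x + δ * m x) ^ 2 = δ⁻¹ * (m x - m' x) ^ 2 + 2 * m x * (m x - m' x)
      + δ * m x ^ 2 := by field_simp; ring
    have e2 : δ⁻¹ * (m x - m' x - δ * m x) ^ 2 = δ⁻¹ * (m x - m' x) ^ 2 - 2 * m x * (m x - m' x)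
      + δ * m x ^ 2 := by field_simp; ring
    rw [abs_le]
    constructor <;> nlinarith [sq_nonneg (m x - m' x)]
  refine (integral_mono (h2'.integrable_sq.sub h2.integrable_sq).abs
    ((hd2.const_mul _).add (h2.integrable_sq.const_mul δ)) hb).trans ?_
  simp only [Pi.add_apply]
  rw [integral_add (hd2.const_mul _) (h2.integrable_sq.const_mul δ), integral_const_mul,
    integral_const_mul]
  have : (1 + δ⁻¹) * ∫ x, (m x - m' x) ^ 2 ∂μ ≤ (1 + δ⁻¹) * δ ^ 2 := by gcongr
  have e : (1 + δ⁻¹) * δ ^ 2 = δ ^ 2 + δ := by field_simp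
  linarith

variable [IsProbabilityMeasure μ] {m : Ω → ℝ}

lemma IsReversedDiff.exists_bounded_approx (hT : MeasurePreserving T μ μ)
    (h : IsReversedDiff μ T m) (h2 : MemLp m 2 μ) {δ : ℝ} (hδ : 0 < δ) :
    ∃ m' : Ω → ℝ, Measurable m' ∧ (∃ M, ∀ x, |m' x| ≤ M) ∧ IsReversedDiff μ T m' ∧
      ∫ x, (m x - m' x) ^ 2 ∂μ ≤ δ ^ 2 := by
  obtain ⟨g, hgm, ⟨R, hR⟩, hg, hg2⟩ : ∃ g : Ω → ℝ, Measurable g ∧ (∃ R, ∀ x, ‖g x‖ ≤ R) ∧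
      eLpNorm (m - g) 2 μ < ENNReal.ofReal (δ / 2) ∧ MemLp g 2 μ := by
    obtain ⟨g, hg, hg2⟩ := h2.exists_simpleFunc_eLpNorm_sub_lt (by norm_num)
      (ε := ENNReal.ofReal (δ / 2)) (by simpa using hδ)
    exact ⟨g, g.measurable, g.exists_forall_norm_le, hg, hg2⟩
  set c := μ[g | mΩ.comap T] with hc
  have hcm : Measurable c := (stronglyMeasurable_condExp.mono hT.measurable.comap_le).measurable
  have hcR : ∀ᵐ x ∂μ, |c x| ≤ R :=
    ae_bdd_abs_condExp_of_ae_bdd_abs (ae_of_all _ fun x => by simpa using hR x)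
  have hgi : Integrable g μ := hg2.integrable (by norm_num)
  have hc2 : MemLp c 2 μ := MemLp.condExp (by norm_num) hg2
  have hci : Integrable c μ := integrable_condExp
  have hd : IsReversedDiff μ T (fun x => g x - c x) := by
    refine ⟨hgi.sub hci, fun A hA => ?_⟩
    rw [integral_sub hgi.integrableOn hci.integrableOn, sub_eq_zero]
    exact (setIntegral_condExp hT.measurable.comap_le hgi ⟨A, hA, rfl⟩).symm
  have hae : (fun x => g x - c x) =ᵐ[μ] fun x => max (-(2 * R)) (min (2 * R) (g x - c x)) := by
    filter_upwards [hcR] with x hx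
    have h1 := abs_le.1 hx
    have h3 := abs_le.1 (show |g x| ≤ R by simpa using hR x)
    rw [min_eq_right (by linarith), max_eq_right (by linarith)]
  refine ⟨fun x => max (-(2 * R)) (min (2 * R) (g x - c x)),
    measurable_const.max (measurable_const.min (hgm.sub hcm)), ⟨2 * R, fun x => ?_⟩,
    hd.congr_ae hae, ?_⟩
  · obtain ⟨y⟩ := nonempty_of_isProbabilityMeasure μ
    have hR0 : 0 ≤ R := (norm_nonneg _).trans (hR y)
    exact abs_le.2 ⟨le_max_left _ _, max_le (by linarith) (min_le_left _ _)⟩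
  · have e1 : ∫ x, (m x - max (-(2 * R)) (min (2 * R) (g x - c x))) ^ 2 ∂μ
        = ∫ x, ((m - g) x - μ[m - g | mΩ.comap T] x) ^ 2 ∂μ := by
      refine integral_congr_ae ?_
      filter_upwards [hae, condExp_sub h.integrable hgi (mΩ.comap T),
        h.condExp_ae_eq_zero hT.measurable] with x hx hx2 hx3
      rw [← hx, hx2, Pi.sub_apply, Pi.sub_apply, hx3, ← hc]
      simp only [Pi.zero_apply]
      ring
    rw [e1]
    have hmg : MemLp (m - g) 2 μ := h2.sub hg2
    have hmc : MemLp (μ[m - g | mΩ.comap T]) 2 μ := MemLp.condExp (by norm_num) hmg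
    refine integral_sq_le_of_eLpNorm_le (hmg.sub hmc) hδ.le ?_
    refine (eLpNorm_sub_le hmg.aestronglyMeasurable hmc.aestronglyMeasurable
      (by norm_num)).trans ?_
    refine (add_le_add le_rfl (eLpNorm_condExp_le_eLpNorm _ (by norm_num))).trans ?_
    refine (add_le_add hg.le hg.le).trans_eq ?_
    rw [← ENNReal.ofReal_add (by positivity) (by positivity), add_halves]

lemma integral_abs_le_of_integral_sq_le {φ : Ω → ℝ} (hφ : MemLp φ 2 μ) {δ : ℝ} (hδ : 0 < δ)
    (h : ∫ x, φ x ^ 2 ∂μ ≤ δ ^ 2) : ∫ x, |φ x| ∂μ ≤ δ := by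
  have h1 : ∀ x, |φ x| ≤ δ / 2 + (2 * δ)⁻¹ * φ x ^ 2 := fun x => by
    have : 0 ≤ (|φ x| - δ) ^ 2 / (2 * δ) := by positivity
    have e : (|φ x| - δ) ^ 2 / (2 * δ) = (2 * δ)⁻¹ * |φ x| ^ 2 + δ / 2 - |φ x| := by
      field_simp; ring
    rw [e, sq_abs] at this
    linarith
  have h2 := integral_mono (hφ.integrable (by norm_num)).abs
    ((integrable_const (δ / 2)).add (hφ.integrable_sq.const_mul (2 * δ)⁻¹)) h1
  refine h2.trans ?_
  simp only [Pi.add_apply]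
  rw [integral_add (integrable_const _) (hφ.integrable_sq.const_mul _), integral_const_mul]
  simp only [integral_const, probReal_univ, one_smul]
  have : (2 * δ)⁻¹ * ∫ x, φ x ^ 2 ∂μ ≤ (2 * δ)⁻¹ * δ ^ 2 := by gcongr
  have e : (2 * δ)⁻¹ * δ ^ 2 = δ / 2 := by field_simp
  linarith

lemma norm_integral_exp_sub_le {X Y : Ω → ℝ} (hX : Integrable X μ) (hY : Integrable Y μ) (t : ℝ) :
    ‖∫ x, Complex.exp ((t * X x : ℝ) * Complex.I) ∂μ
      - ∫ x, Complex.exp ((t * Y x : ℝ) * Complex.I) ∂μ‖ ≤ |t| * ∫ x, |X x - Y x| ∂μ := by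
  have hi : ∀ {Z : Ω → ℝ}, Integrable Z μ →
      Integrable (fun x => Complex.exp ((t * Z x : ℝ) * Complex.I)) μ := fun hZ => by
    refine Integrable.of_bound (Complex.continuous_exp.comp_aestronglyMeasurable
      ((Complex.continuous_ofReal.comp_aestronglyMeasurable
        (hZ.const_mul t).aestronglyMeasurable).mul_const Complex.I)) 1 (ae_of_all _ fun x => ?_)
    simp only [Complex.norm_exp_ofReal_mul_I, le_refl]
  rw [← integral_sub (hi hX) (hi hY), ← integral_const_mul]
  refine norm_integral_le_of_norm_le ((hX.sub hY).abs.const_mul _) (ae_of_all _ fun x => ?_)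
  have e : Complex.exp ((t * X x : ℝ) * Complex.I) - Complex.exp ((t * Y x : ℝ) * Complex.I)
      = Complex.exp ((t * Y x : ℝ) * Complex.I)
        * (Complex.exp (Complex.I * ((t * (X x - Y x) : ℝ) : ℂ)) - 1) := by
    rw [mul_sub, ← Complex.exp_add, mul_one]
    congr 2
    push_cast; ring
  rw [e, norm_mul, Complex.norm_exp_ofReal_mul_I, one_mul]
  refine Real.norm_exp_I_mul_ofReal_sub_one_le.trans_eq ?_
  rw [Real.norm_eq_abs, abs_mul]

lemma IsReversedDiff.tendsto_charFun (hT : MeasurePreserving T μ μ)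
    (h : IsReversedDiff μ T m) (hm : Measurable m) (h2 : MemLp m 2 μ)
    (hE : ∀ φ : Ω → ℝ, Integrable φ μ → MeanErgodic μ T φ) (t : ℝ) :
    Tendsto (fun n : ℕ => ∫ x, Complex.exp
      ((t * ((√n)⁻¹ * birkhoffSum T m n x) : ℝ) * Complex.I) ∂μ) atTop
      (𝓝 (Real.exp (-(t ^ 2 * (∫ x, m x ^ 2 ∂μ) / 2)) : ℝ)) := by
  set σ := ∫ x, m x ^ 2 ∂μ with hσ
  have hσ0 : 0 ≤ σ := integral_nonneg fun x => sq_nonneg _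
  rw [Metric.tendsto_atTop]
  intro ε hε
  have hc : Tendsto (fun δ : ℝ => |t| * δ + t ^ 2 / 2 * (δ ^ 2 + δ * σ + δ)) (𝓝[>] 0) (𝓝 0) := by
    have : Continuous (fun δ : ℝ => |t| * δ + t ^ 2 / 2 * (δ ^ 2 + δ * σ + δ)) := by fun_prop
    exact (this.tendsto' 0 0 (by simp)).mono_left nhdsWithin_le_nhds
  obtain ⟨δ, hδε, hδ⟩ := ((hc.eventually_lt_const (half_pos hε)).and self_mem_nhdsWithin).exists
  replace hδ : 0 < δ := hδ
  obtain ⟨m', hm', ⟨M, hM⟩, hd', hmm'⟩ := h.exists_bounded_approx hT h2 hδ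
  have h2' : MemLp m' 2 μ := MemLp.of_bound hm'.aestronglyMeasurable M (ae_of_all _ hM)
  have hlim := hd'.tendsto_charFun_of_bounded hT hm' hM (hE _ h2'.integrable_sq) t
  obtain ⟨N, hN⟩ := Metric.tendsto_atTop.1 hlim (ε / 2) (half_pos hε)
  refine ⟨N, fun n hn => ?_⟩
  have hdiff : ‖∫ x, Complex.exp ((t * ((√n)⁻¹ * birkhoffSum T m n x) : ℝ) * Complex.I) ∂μ
      - ∫ x, Complex.exp ((t * ((√n)⁻¹ * birkhoffSum T m' n x) : ℝ) * Complex.I) ∂μ‖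
      ≤ |t| * δ := by
    refine (norm_integral_exp_sub_le ((integrable_birkhoffSum hT h.integrable n).const_mul _)
      ((integrable_birkhoffSum hT hd'.integrable n).const_mul _) t).trans ?_
    gcongr
    simp only [← mul_sub, ← birkhoffSum_sub_fun]
    have hS2 := memLp_birkhoffSum hT (h2.sub h2') n
    refine integral_abs_le_of_integral_sq_le (hS2.const_mul _) hδ ?_
    simp only [mul_pow]
    rw [integral_const_mul]
    erw [(h.sub hd').integral_birkhoffSum_sq hT (hm.sub hm') (h2.sub h2')]
    rw [inv_pow, Real.sq_sqrt (Nat.cast_nonneg n), ← mul_assoc]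
    refine (mul_le_of_le_one_left (integral_nonneg fun x => sq_nonneg _) ?_).trans hmm'
    rcases eq_or_ne (n : ℝ) 0 with h0 | h0
    · simp [h0]
    · rw [inv_mul_cancel₀ h0]
  have hexp : ‖((Real.exp (-(t ^ 2 * (∫ x, m' x ^ 2 ∂μ) / 2)) : ℝ) : ℂ)
      - ((Real.exp (-(t ^ 2 * σ / 2)) : ℝ) : ℂ)‖ ≤ t ^ 2 / 2 * (δ ^ 2 + δ * σ + δ) := by
    rw [← Complex.ofReal_sub, Complex.norm_real, Real.norm_eq_abs]
    have hσ0' : 0 ≤ ∫ x, m' x ^ 2 ∂μ := integral_nonneg fun x => sq_nonneg _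
    refine (abs_exp_sub_exp_le (c := 0) (by simp; positivity) (by simp; positivity)).trans ?_
    rw [Real.exp_zero, one_mul]
    have e : -(t ^ 2 * (∫ x, m' x ^ 2 ∂μ) / 2) - -(t ^ 2 * σ / 2)
        = -(t ^ 2 / 2 * (∫ x, m' x ^ 2 ∂μ - σ)) := by ring
    rw [e, abs_neg, abs_mul, abs_of_nonneg (show 0 ≤ t ^ 2 / 2 by positivity)]
    gcongr
    exact abs_integral_sq_sub_le h2 h2' hδ hmm'
  have h3 := hN n hn
  rw [dist_eq_norm] at h3 ⊢
  calc _ ≤ _ := norm_sub_le_norm_sub_add_norm_sub _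
        (∫ x, Complex.exp ((t * ((√n)⁻¹ * birkhoffSum T m' n x) : ℝ) * Complex.I) ∂μ) _
    _ ≤ |t| * δ + (_ + _) := add_le_add hdiff (norm_sub_le_norm_sub_add_norm_sub _
        ((Real.exp (-(t ^ 2 * (∫ x, m' x ^ 2 ∂μ) / 2)) : ℝ) : ℂ) _)
    _ < ε := by linarith

end MartingaleCLT

section Coboundary

variable {Ω : Type*} [MeasurableSpace Ω] {μ : Measure Ω} {T : Ω → Ω} {m f h : Ω → ℝ}

lemma birkhoffSum_of_coboundary {Ω : Type*} {T : Ω → Ω} {m f h : Ω → ℝ}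
    (hf : ∀ x, f x = m x + (h (T x) - h x)) (n : ℕ) (x : Ω) :
    birkhoffSum T f n x = birkhoffSum T m n x + (h (T^[n] x) - h x) := by
  induction n with
  | zero => simp
  | succ n ih =>
    rw [birkhoffSum_succ, birkhoffSum_succ, ih, hf, Function.iterate_succ_apply' T n x]
    ring

variable [IsProbabilityMeasure μ]

lemma tendsto_integral_min_coboundary (hT : MeasurePreserving T μ μ) (hh : Measurable h)
    {M : ℝ} (hM : 0 ≤ M) {c : ℕ → ℝ} (hc : Tendsto c atTop (𝓝 0)) :
    Tendsto (fun n => ∫ x, min M |c n * (h (T^[n] x) - h x)| ∂μ) atTop (𝓝 0) := by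
  have hm : ∀ n {g : Ω → ℝ}, Measurable g → Measurable fun x => min M |c n * g x| :=
    fun n g hg => measurable_const.min (hg.const_mul _).norm
  have hi : ∀ n {g : Ω → ℝ}, Measurable g → Integrable (fun x => min M |c n * g x|) μ :=
    fun n g hg => Integrable.of_bound (hm n hg).aestronglyMeasurable M (ae_of_all _ fun x => by
      rw [Real.norm_eq_abs, abs_of_nonneg (le_min hM (abs_nonneg _))]
      exact min_le_left _ _)
  have hlim : Tendsto (fun n => 2 * ∫ x, min M |c n * h x| ∂μ) atTop (𝓝 0) := by
    have := tendsto_integral_of_dominated_convergence (μ := μ)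
      (F := fun n x => min M |c n * h x|) (f := fun _ => 0) (fun _ => M)
      (fun n => (hm n hh).aestronglyMeasurable) (integrable_const _)
      (fun n => ae_of_all _ fun x => by
        rw [Real.norm_eq_abs, abs_of_nonneg (le_min hM (abs_nonneg _))]
        exact min_le_left _ _)
      (ae_of_all _ fun x => by
        have h1 := (hc.mul_const (h x)).abs
        simpa [hM] using (tendsto_const_nhds (x := M)).min h1)
    simpa using this.const_mul 2
  refine squeeze_zero (fun n => integral_nonneg fun x => le_min hM (abs_nonneg _)) (fun n => ?_)
    hlim
  have e : ∫ x, min M |c n * h (T^[n] x)| ∂μ = ∫ x, min M |c n * h x| ∂μ :=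
    integral_comp_of_measurePreserving (hT.iterate n) (φ := fun x => min M |c n * h x|)
      (hm n hh).aestronglyMeasurable
  have hhT : Measurable fun x => h (T^[n] x) := hh.comp (hT.measurable.iterate n)
  rw [two_mul]
  nth_rw 1 [← e]
  rw [← integral_add (hi n hhT) (hi n hh)]
  refine integral_mono (hi n (hhT.sub hh)) ((hi n hhT).add (hi n hh)) fun x => ?_
  have h1 : |c n * (h (T^[n] x) - h x)| ≤ |c n * h (T^[n] x)| + |c n * h x| := by
    rw [mul_sub]; exact abs_sub _ _
  beta_reduce
  rcases min_cases M |c n * h (T^[n] x)| with ⟨h2, h3⟩ | ⟨h2, h3⟩ <;>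
  rcases min_cases M |c n * h x| with ⟨h4, h5⟩ | ⟨h4, h5⟩ <;> rw [h2, h4]
  · exact (min_le_left _ _).trans (by linarith)
  · exact (min_le_left _ _).trans (by linarith [abs_nonneg (c n * h x)])
  · exact (min_le_left _ _).trans (by linarith [abs_nonneg (c n * h (T^[n] x))])
  · exact (min_le_right _ _).trans h1

lemma IsReversedDiff.meanErgodic_of_coboundary (hT : MeasurePreserving T μ μ)
    (hd : IsReversedDiff μ T m) (hm : Measurable m) (h2 : MemLp m 2 μ) (hh : Measurable h)
    (hf : ∀ x, f x = m x + (h (T x) - h x)) {M : ℝ} (hM : ∀ x, |f x| ≤ M)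
    (hf0 : ∫ x, f x ∂μ = 0) : MeanErgodic μ T f := by
  have hM0 : 0 ≤ M := by
    obtain ⟨x⟩ := nonempty_of_isProbabilityMeasure μ
    exact (abs_nonneg _).trans (hM x)
  have hfm : Measurable f := by
    rw [show f = fun x => m x + (h (T x) - h x) from funext hf]
    exact hm.add ((hh.comp hT.measurable).sub hh)
  rw [MeanErgodic, hf0]
  simp only [sub_zero]
  have hA : Tendsto (fun n : ℕ => ∫ x, |(n : ℝ)⁻¹ * birkhoffSum T m n x| ∂μ) atTop (𝓝 0) := by
    rw [Metric.tendsto_atTop]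
    intro ε hε
    have hs : Tendsto (fun n : ℕ => (n : ℝ)⁻¹ * ∫ x, m x ^ 2 ∂μ) atTop (𝓝 0) := by
      simpa using! (tendsto_inv_atTop_zero.comp tendsto_natCast_atTop_atTop).mul_const
        (∫ x, m x ^ 2 ∂μ)
    have hev := hs.eventually_le_const (show 0 < (ε / 2) ^ 2 by positivity)
    obtain ⟨N, hN⟩ := eventually_atTop.1 (hev.and (eventually_gt_atTop 0))
    refine ⟨N, fun n hn => ?_⟩
    obtain ⟨h1, h0⟩ := hN n hn
    rw [Real.dist_0_eq_abs, abs_of_nonneg (integral_nonneg fun x => abs_nonneg _)]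
    refine (integral_abs_le_of_integral_sq_le ((memLp_birkhoffSum hT h2 n).const_mul _)
      (half_pos hε) ?_).trans_lt (half_lt_self hε)
    simp only [mul_pow]
    rw [integral_const_mul, hd.integral_birkhoffSum_sq hT hm h2, ← mul_assoc]
    refine le_trans (le_of_eq ?_) h1
    have : (n : ℝ) ≠ 0 := by exact_mod_cast h0.ne'
    field_simp
  have hB := tendsto_integral_min_coboundary hT hh hM0 (c := fun n => (n : ℝ)⁻¹)
    (tendsto_inv_atTop_zero.comp tendsto_natCast_atTop_atTop)
  have hAB := hA.add hB
  rw [add_zero] at hAB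
  refine squeeze_zero (fun n => integral_nonneg fun x => abs_nonneg _) (fun n => ?_) hAB
  have hfi : Integrable f μ := Integrable.of_bound hfm.aestronglyMeasurable M (ae_of_all _ hM)
  have i1 : Integrable (fun x => |(n : ℝ)⁻¹ * birkhoffSum T m n x|) μ :=
    ((integrable_birkhoffSum hT hd.integrable n).const_mul _).abs
  have i2 : Integrable (fun x => min M |(n : ℝ)⁻¹ * (h (T^[n] x) - h x)|) μ := by
    refine Integrable.of_bound (measurable_const.min (((hh.comp (hT.measurable.iterate n)).sub
      hh).const_mul _).norm).aestronglyMeasurable M (ae_of_all _ fun x => ?_)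
    rw [Real.norm_eq_abs, abs_of_nonneg (le_min hM0 (abs_nonneg _))]
    exact min_le_left _ _
  rw [← integral_add i1 i2]
  refine integral_mono ((integrable_birkhoffSum hT hfi n).const_mul _).abs (i1.add i2) fun x => ?_
  beta_reduce
  have hS : |(n : ℝ)⁻¹ * birkhoffSum T f n x| ≤ M := by
    rcases Nat.eq_zero_or_pos n with h0 | h0
    · simp [h0, hM0]
    · have h0' : (0 : ℝ) < n := by exact_mod_cast h0
      rw [abs_mul, abs_of_pos (inv_pos.2 h0'), inv_mul_le_iff₀ h0']
      refine (Finset.abs_sum_le_sum_abs _ _).trans ((Finset.sum_le_sum fun i _ => hM _).trans_eq ?_)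
      simp
  rcases min_cases M |(n : ℝ)⁻¹ * (h (T^[n] x) - h x)| with ⟨h3, h4⟩ | ⟨h3, h4⟩ <;> rw [h3]
  · linarith [abs_nonneg ((n : ℝ)⁻¹ * birkhoffSum T m n x)]
  · rw [birkhoffSum_of_coboundary hf, mul_add]
    exact abs_add_le _ _

lemma norm_integral_exp_sub_le_min {X Y : Ω → ℝ} (hX : Measurable X) (hY : Measurable Y) :
    ‖∫ x, Complex.exp ((X x : ℂ) * Complex.I) ∂μ - ∫ x, Complex.exp ((Y x : ℂ) * Complex.I) ∂μ‖
      ≤ ∫ x, min 2 |X x - Y x| ∂μ := by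
  have hi : ∀ {Z : Ω → ℝ}, Measurable Z →
      Integrable (fun x => Complex.exp ((Z x : ℂ) * Complex.I)) μ := fun hZ =>
    Integrable.of_bound (Complex.measurable_exp.comp
      ((Complex.measurable_ofReal.comp hZ).mul_const Complex.I)).aestronglyMeasurable 1
      (ae_of_all _ fun x => by simp only [Complex.norm_exp_ofReal_mul_I, le_refl])
  have him : Integrable (fun x => min 2 |X x - Y x|) μ :=
    Integrable.of_bound (measurable_const.min (hX.sub hY).norm).aestronglyMeasurable 2
      (ae_of_all _ fun x => by
        rw [Real.norm_eq_abs, abs_of_nonneg (le_min zero_le_two (abs_nonneg _))]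
        exact min_le_left _ _)
  rw [← integral_sub (hi hX) (hi hY)]
  refine norm_integral_le_of_norm_le him (ae_of_all _ fun x => le_min ?_ ?_)
  · refine (norm_sub_le _ _).trans ?_
    rw [Complex.norm_exp_ofReal_mul_I, Complex.norm_exp_ofReal_mul_I]; norm_num
  · have e : Complex.exp ((X x : ℂ) * Complex.I) - Complex.exp ((Y x : ℂ) * Complex.I)
        = Complex.exp ((Y x : ℂ) * Complex.I)
          * (Complex.exp (Complex.I * ((X x - Y x : ℝ) : ℂ)) - 1) := by
      rw [mul_sub, ← Complex.exp_add, mul_one]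
      congr 2
      push_cast; ring
    rw [e, norm_mul, Complex.norm_exp_ofReal_mul_I, one_mul]
    exact Real.norm_exp_I_mul_ofReal_sub_one_le

lemma IsReversedDiff.tendsto_integral_of_coboundary (hT : MeasurePreserving T μ μ)
    (hd : IsReversedDiff μ T m) (hm : Measurable m) (h2 : MemLp m 2 μ)
    (hE : ∀ φ : Ω → ℝ, Integrable φ μ → MeanErgodic μ T φ) (hh : Measurable h)
    (hf : ∀ x, f x = m x + (h (T x) - h x)) :
    ∃ v : ℝ≥0, ∀ g : BoundedContinuousFunction ℝ ℝ,
      Tendsto (fun n : ℕ => ∫ x, g ((√n)⁻¹ * birkhoffSum T f n x) ∂μ) atTop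
        (𝓝 (∫ y, g y ∂(gaussianReal 0 v))) := by
  have hfm : Measurable f := by
    rw [show f = fun x => m x + (h (T x) - h x) from funext hf]
    exact hm.add ((hh.comp hT.measurable).sub hh)
  have hSf : ∀ n : ℕ, Measurable fun x => (√(n : ℝ))⁻¹ * birkhoffSum T f n x := fun n =>
    (measurable_birkhoffSum hT.measurable hfm n).const_mul _
  have hSm : ∀ n : ℕ, Measurable fun x => (√(n : ℝ))⁻¹ * birkhoffSum T m n x := fun n =>
    (measurable_birkhoffSum hT.measurable hm n).const_mul _
  set v : ℝ≥0 := ⟨∫ x, m x ^ 2 ∂μ, integral_nonneg fun x => sq_nonneg _⟩ with hv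
  have hchar : ∀ t : ℝ, Tendsto (fun n : ℕ => ∫ x, Complex.exp
      ((t * ((√n)⁻¹ * birkhoffSum T f n x) : ℝ) * Complex.I) ∂μ) atTop
      (𝓝 (Real.exp (-(t ^ 2 * (∫ x, m x ^ 2 ∂μ) / 2)) : ℝ)) := fun t => by
    refine tendsto_of_tendsto_of_dist (hd.tendsto_charFun hT hm h2 hE t) ?_
    have hc : Tendsto (fun n : ℕ => t * (√(n : ℝ))⁻¹) atTop (𝓝 0) := by
      simpa using! (tendsto_inv_atTop_zero.comp
        (Real.tendsto_sqrt_atTop.comp tendsto_natCast_atTop_atTop)).const_mul t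
    refine squeeze_zero (fun n => dist_nonneg) (fun n => ?_)
      (tendsto_integral_min_coboundary hT hh zero_le_two hc)
    rw [dist_comm, dist_eq_norm]
    refine (norm_integral_exp_sub_le_min ((hSf n).const_mul t) ((hSm n).const_mul t)).trans_eq ?_
    congr 1 with x
    rw [birkhoffSum_of_coboundary hf]
    congr 2
    ring
  refine ⟨v, ?_⟩
  let P : ℕ → ProbabilityMeasure ℝ := fun n =>
    ⟨μ.map fun x => (√(n : ℝ))⁻¹ * birkhoffSum T f n x,
      Measure.isProbabilityMeasure_map (hSf n).aemeasurable⟩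
  let G : ProbabilityMeasure ℝ := ⟨gaussianReal 0 v, inferInstance⟩
  have hP : Tendsto P atTop (𝓝 G) := by
    rw [ProbabilityMeasure.tendsto_iff_tendsto_charFun]
    intro t
    have e1 : charFun (gaussianReal 0 v) t
        = (Real.exp (-(t ^ 2 * (∫ x, m x ^ 2 ∂μ) / 2)) : ℝ) := by
      rw [charFun_gaussianReal, Complex.ofReal_exp]
      congr 1
      rw [show (v : ℝ) = ∫ x, m x ^ 2 ∂μ from rfl]
      push_cast
      ring
    change Tendsto _ _ (𝓝 (charFun (gaussianReal 0 v) t))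
    rw [e1]
    refine (hchar t).congr fun n => ?_
    simp only [P, ProbabilityMeasure.coe_mk, charFun_apply_real]
    rw [integral_map (hSf n).aemeasurable (by fun_prop)]
    push_cast
    rfl
  intro g
  have := ProbabilityMeasure.tendsto_iff_forall_integral_tendsto.1 hP g
  simp only [G, ProbabilityMeasure.coe_mk] at this
  refine this.congr fun n => ?_
  simp only [P, ProbabilityMeasure.coe_mk]
  rw [integral_map (hSf n).aemeasurable g.continuous.aestronglyMeasurable]

end Coboundary

/-! ### The left inverse branch of the intermittent map -/

section Branch

/-- Extension to `ℝ` of the left branch of the intermittent map, equal to the identity on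
`(-∞, 0]`. -/
def leftBranch (γ y : ℝ) : ℝ := y + 2 ^ γ * (max y 0 * max y 0 ^ γ)

/-- Inverse of the left branch. -/
def invBranch (γ : ℝ) : ℝ → ℝ := Function.invFun (leftBranch γ)

/-- Derivative of the inverse of the left branch. -/
def invDeriv (γ x : ℝ) : ℝ := (1 + (1 + γ) * (2 ^ γ * max (invBranch γ x) 0 ^ γ))⁻¹

/-- Derivative of the `k`-th iterate of the inverse of the left branch. -/
def iterDeriv (γ : ℝ) (k : ℕ) (x : ℝ) : ℝ :=
  ∏ j ∈ Finset.range k, invDeriv γ ((invBranch γ)^[j] x)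

variable {γ : ℝ}

lemma strictMono_leftBranch (hγ : 0 < γ) : StrictMono (leftBranch γ) := by
  refine strictMono_id.add_monotone fun x y hxy => ?_
  have : max x 0 ≤ max y 0 := max_le_max_right 0 hxy
  have h0 : 0 ≤ max x 0 := le_max_right _ _
  gcongr

lemma continuous_leftBranch (hγ : 0 < γ) : Continuous (leftBranch γ) := by
  have h : Continuous fun y : ℝ => max y 0 := continuous_id.max continuous_const
  exact continuous_id.add (continuous_const.mul (h.mul (h.rpow_const fun _ => Or.inr hγ.le)))

lemma leftBranch_of_nonpos {y : ℝ} (hy : y ≤ 0) : leftBranch γ y = y := by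
  simp [leftBranch, max_eq_right hy]

lemma leftBranch_of_nonneg {y : ℝ} (hy : 0 ≤ y) : leftBranch γ y = y * (1 + 2 ^ γ * y ^ γ) := by
  simp only [leftBranch, max_eq_left hy]; ring

lemma leftBranch_eq_add {y : ℝ} (hy : 0 ≤ y) : leftBranch γ y = y + y * (2 * y) ^ γ := by
  rw [leftBranch_of_nonneg hy, Real.mul_rpow zero_le_two hy]; ring

lemma surjective_leftBranch (hγ : 0 < γ) : Function.Surjective (leftBranch γ) := by
  refine (continuous_leftBranch hγ).surjective ?_ ?_
  · refine tendsto_atTop_mono (fun y => ?_) tendsto_id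
    simp only [leftBranch, id, le_add_iff_nonneg_right]
    positivity
  · refine tendsto_id.congr' ?_
    filter_upwards [eventually_le_atBot 0] with y hy
    rw [leftBranch_of_nonpos hy, id]

lemma leftBranch_invBranch (hγ : 0 < γ) (x : ℝ) : leftBranch γ (invBranch γ x) = x :=
  Function.rightInverse_invFun (surjective_leftBranch hγ) x

lemma invBranch_leftBranch (hγ : 0 < γ) (x : ℝ) : invBranch γ (leftBranch γ x) = x :=
  Function.leftInverse_invFun (strictMono_leftBranch hγ).injective x

lemma strictMono_invBranch (hγ : 0 < γ) : StrictMono (invBranch γ) := fun x y hxy => by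
  rwa [← (strictMono_leftBranch hγ).lt_iff_lt, leftBranch_invBranch hγ, leftBranch_invBranch hγ]

lemma continuous_invBranch (hγ : 0 < γ) : Continuous (invBranch γ) :=
  (strictMono_invBranch hγ).monotone.continuous_of_surjective
    fun x => ⟨_, invBranch_leftBranch hγ x⟩

lemma invBranch_zero (hγ : 0 < γ) : invBranch γ 0 = 0 := by
  conv_lhs => rw [← leftBranch_of_nonpos (γ := γ) le_rfl]
  exact invBranch_leftBranch hγ 0

lemma invBranch_one (hγ : 0 < γ) : invBranch γ 1 = 1 / 2 := by
  rw [← invBranch_leftBranch hγ (1 / 2), leftBranch_eq_add (by norm_num)]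
  norm_num

lemma invBranch_pos (hγ : 0 < γ) {x : ℝ} (hx : 0 < x) : 0 < invBranch γ x := by
  rw [← invBranch_zero hγ]; exact strictMono_invBranch hγ hx

lemma sub_invBranch (hγ : 0 < γ) {x : ℝ} (hx : 0 < x) :
    x - invBranch γ x = invBranch γ x * (2 * invBranch γ x) ^ γ := by
  have := leftBranch_eq_add (γ := γ) (invBranch_pos hγ hx).le
  rw [leftBranch_invBranch hγ] at this
  linarith

lemma invBranch_lt_self (hγ : 0 < γ) {x : ℝ} (hx : 0 < x) : invBranch γ x < x := by
  have h0 := invBranch_pos hγ hx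
  have := sub_invBranch hγ hx
  have : 0 < invBranch γ x * (2 * invBranch γ x) ^ γ := by positivity
  linarith

lemma half_le_invBranch (hγ : 0 < γ) {x : ℝ} (hx : 0 < x) (hx1 : x ≤ 1) :
    x / 2 ≤ invBranch γ x := by
  rw [← (strictMono_leftBranch hγ).le_iff_le, leftBranch_invBranch hγ,
    leftBranch_eq_add (by positivity), mul_div_cancel₀ x two_ne_zero]
  have : x ^ γ ≤ 1 := Real.rpow_le_one hx.le hx1 hγ.le
  nlinarith

lemma invBranch_le_half (hγ : 0 < γ) {x : ℝ} (hx1 : x ≤ 1) : invBranch γ x ≤ 1 / 2 := by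
  rw [← invBranch_one hγ]; exact (strictMono_invBranch hγ).monotone hx1

lemma invDeriv_pos (hγ : 0 < γ) (x : ℝ) : 0 < invDeriv γ x := by
  unfold invDeriv; positivity

lemma invDeriv_le_one (hγ : 0 < γ) (x : ℝ) : invDeriv γ x ≤ 1 := by
  refine inv_le_one_of_one_le₀ ?_
  rw [le_add_iff_nonneg_right]; positivity

lemma antitone_invDeriv (hγ : 0 < γ) : Antitone (invDeriv γ) := fun x y hxy => by
  have h : max (invBranch γ x) 0 ≤ max (invBranch γ y) 0 :=
    max_le_max_right 0 ((strictMono_invBranch hγ).monotone hxy)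
  have h0 : 0 ≤ max (invBranch γ x) 0 := le_max_right _ _
  unfold invDeriv
  gcongr

lemma invDeriv_one (hγ : 0 < γ) : invDeriv γ 1 = (2 + γ)⁻¹ := by
  rw [invDeriv, invBranch_one hγ, max_eq_left (by norm_num),
    ← Real.mul_rpow (by norm_num) (by norm_num)]
  norm_num
  ring

lemma two_fifths_le_invDeriv (hγ : 0 < γ) (hγ' : γ < 1 / 2) {x : ℝ} (hx : x ≤ 1) :
    2 / 5 ≤ invDeriv γ x := by
  refine le_trans ?_ (antitone_invDeriv hγ hx)
  rw [invDeriv_one hγ, le_inv_comm₀ (by norm_num) (by positivity)]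
  linarith

lemma hasDerivAt_invBranch (hγ : 0 < γ) {x : ℝ} (hx : 0 < x) :
    HasDerivAt (invBranch γ) (invDeriv γ x) x := by
  have h0 := invBranch_pos hγ hx
  refine HasDerivAt.of_local_left_inverse (f := leftBranch γ) (continuous_invBranch hγ).continuousAt
    ?_ (by positivity) (Eventually.of_forall (leftBranch_invBranch hγ))
  have h1 : HasDerivAt (fun y : ℝ => y + 2 ^ γ * y ^ (1 + γ))
      (1 + 2 ^ γ * ((1 + γ) * invBranch γ x ^ (1 + γ - 1))) (invBranch γ x) :=
    (hasDerivAt_id _).add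
      ((Real.hasDerivAt_rpow_const (Or.inl h0.ne')).const_mul _)
  rw [max_eq_left h0.le]
  have h2 : leftBranch γ =ᶠ[𝓝 (invBranch γ x)] fun y => y + 2 ^ γ * y ^ (1 + γ) := by
    filter_upwards [lt_mem_nhds h0] with y hy
    rw [leftBranch_of_nonneg hy.le, Real.rpow_add hy, Real.rpow_one]; ring
  have e : 1 + (1 + γ) * (2 ^ γ * invBranch γ x ^ γ)
      = 1 + 2 ^ γ * ((1 + γ) * invBranch γ x ^ (1 + γ - 1)) := by
    rw [add_sub_cancel_left]; ring
  rw [e]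
  exact h1.congr_of_eventuallyEq h2

lemma iterDeriv_pos (hγ : 0 < γ) (k : ℕ) (x : ℝ) : 0 < iterDeriv γ k x :=
  Finset.prod_pos fun _ _ => invDeriv_pos hγ _

lemma iterDeriv_succ (k : ℕ) (x : ℝ) :
    iterDeriv γ (k + 1) x = invDeriv γ x * iterDeriv γ k (invBranch γ x) := by
  rw [iterDeriv, Finset.prod_range_succ', mul_comm]; rfl

lemma antitone_iterDeriv (hγ : 0 < γ) (k : ℕ) : Antitone (iterDeriv γ k) := fun _ _ hxy =>
  Finset.prod_le_prod (fun _ _ => (invDeriv_pos hγ _).le) fun j _ =>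
    antitone_invDeriv hγ ((strictMono_invBranch hγ).monotone.iterate j hxy)

lemma invBranch_iterate_pos (hγ : 0 < γ) (k : ℕ) {x : ℝ} (hx : 0 < x) :
    0 < (invBranch γ)^[k] x := by
  induction k with
  | zero => simpa
  | succ k ih => rw [Function.iterate_succ_apply']; exact invBranch_pos hγ ih

lemma antitone_invBranch_iterate (hγ : 0 < γ) {x : ℝ} (hx : 0 < x) :
    Antitone fun k => (invBranch γ)^[k] x :=
  antitone_nat_of_succ_le fun k => by
    rw [Function.iterate_succ_apply']
    exact (invBranch_lt_self hγ (invBranch_iterate_pos hγ k hx)).le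

lemma tendsto_invBranch_iterate (hγ : 0 < γ) {x : ℝ} (hx : 0 < x) :
    Tendsto (fun k => (invBranch γ)^[k] x) atTop (𝓝 0) := by
  have hbdd : BddBelow (Set.range fun k => (invBranch γ)^[k] x) :=
    ⟨0, by rintro _ ⟨k, rfl⟩; exact (invBranch_iterate_pos hγ k hx).le⟩
  have hlim := tendsto_atTop_ciInf (antitone_invBranch_iterate hγ hx) hbdd
  set l := ⨅ k, (invBranch γ)^[k] x with hl
  have hl0 : 0 ≤ l := le_ciInf fun k => (invBranch_iterate_pos hγ k hx).le
  have hfix : invBranch γ l = l :=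
    isFixedPt_of_tendsto_iterate hlim (continuous_invBranch hγ).continuousAt
  rcases hl0.eq_or_lt with h | h
  · rwa [← h] at hlim
  · exact absurd hfix (invBranch_lt_self hγ h).ne

lemma hasDerivAt_invBranch_iterate (hγ : 0 < γ) (k : ℕ) {x : ℝ} (hx : 0 < x) :
    HasDerivAt (invBranch γ)^[k] (iterDeriv γ k x) x := by
  induction k with
  | zero => simpa [iterDeriv] using! hasDerivAt_id x
  | succ k ih =>
    rw [Function.iterate_succ']
    have := (hasDerivAt_invBranch hγ (invBranch_iterate_pos hγ k hx)).comp x ih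
    rwa [iterDeriv, Finset.prod_range_succ, mul_comm]

lemma exists_iterate_sub_eq (hγ : 0 < γ) (k : ℕ) {a b : ℝ} (ha : 0 < a) (hab : a < b) :
    ∃ c ∈ Set.Ioo a b,
      (invBranch γ)^[k] b - (invBranch γ)^[k] a = (b - a) * iterDeriv γ k c := by
  obtain ⟨c, hc, h⟩ := exists_hasDerivAt_eq_slope (invBranch γ)^[k] (iterDeriv γ k) hab
    ((continuous_invBranch hγ).iterate k).continuousOn
    fun x hx => hasDerivAt_invBranch_iterate hγ k (ha.trans hx.1)
  refine ⟨c, hc, ?_⟩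
  rw [h, mul_div_cancel₀ _ (sub_pos.2 hab).ne']

lemma iterate_sub_le (hγ : 0 < γ) (k : ℕ) {a b : ℝ} (ha : 0 < a) (hab : a < b) :
    (invBranch γ)^[k] b - (invBranch γ)^[k] a ≤ (b - a) * iterDeriv γ k a := by
  obtain ⟨c, hc, h⟩ := exists_iterate_sub_eq hγ k ha hab
  rw [h]
  exact mul_le_mul_of_nonneg_left (antitone_iterDeriv hγ k hc.1.le) (sub_pos.2 hab).le

lemma le_iterate_sub (hγ : 0 < γ) (k : ℕ) {a b : ℝ} (ha : 0 < a) (hab : a < b) :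
    (b - a) * iterDeriv γ k b ≤ (invBranch γ)^[k] b - (invBranch γ)^[k] a := by
  obtain ⟨c, hc, h⟩ := exists_iterate_sub_eq hγ k ha hab
  rw [h]
  exact mul_le_mul_of_nonneg_left (antitone_iterDeriv hγ k hc.2.le) (sub_pos.2 hab).le

lemma invBranch_iterate_image_Ioc (hγ : 0 < γ) (k : ℕ) (a b : ℝ) :
    (invBranch γ)^[k] '' Set.Ioc a b
      = Set.Ioc ((invBranch γ)^[k] a) ((invBranch γ)^[k] b) := by
  have hm := (strictMono_invBranch hγ).iterate k
  have hs : Function.Surjective (invBranch γ)^[k] :=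
    Function.Surjective.iterate (fun x => ⟨_, invBranch_leftBranch hγ x⟩) k
  ext y
  constructor
  · rintro ⟨x, hx, rfl⟩
    exact ⟨hm hx.1, hm.monotone hx.2⟩
  · rintro ⟨h1, h2⟩
    obtain ⟨x, rfl⟩ := hs y
    exact ⟨x, ⟨hm.lt_iff_lt.1 h1, hm.le_iff_le.1 h2⟩, rfl⟩

lemma setLIntegral_iterDeriv_mul (hγ : 0 < γ) (k : ℕ) {a b : ℝ} (ha : 0 ≤ a) (F : ℝ → ℝ≥0∞) :
    ∫⁻ x in Set.Ioc a b, ENNReal.ofReal (iterDeriv γ k x) * F ((invBranch γ)^[k] x)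
      = ∫⁻ x in Set.Ioc ((invBranch γ)^[k] a) ((invBranch γ)^[k] b), F x := by
  rw [← invBranch_iterate_image_Ioc hγ,
    lintegral_image_eq_lintegral_abs_deriv_mul measurableSet_Ioc
      (fun x hx => (hasDerivAt_invBranch_iterate hγ k (ha.trans_lt hx.1)).hasDerivWithinAt)
      ((strictMono_invBranch hγ).iterate k).injective.injOn]
  simp only [abs_of_pos (iterDeriv_pos hγ _ _)]

lemma tsum_setLIntegral_iterate (hγ : 0 < γ) {z : ℝ} (hz : 0 < z) (v : ℝ → ℝ≥0∞) :
    ∑' k, ∫⁻ x in Set.Ioc ((invBranch γ)^[k + 1] z) ((invBranch γ)^[k] z), v x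
      = ∫⁻ x in Set.Ioc 0 z, v x := by
  have hanti := antitone_invBranch_iterate hγ hz
  have hU : ⋃ k, Set.Ioc ((invBranch γ)^[k + 1] z) ((invBranch γ)^[k] z) = Set.Ioc 0 z := by
    ext x
    simp only [Set.mem_iUnion, Set.mem_Ioc]
    constructor
    · rintro ⟨k, h1, h2⟩
      exact ⟨(invBranch_iterate_pos hγ _ hz).trans h1, h2.trans (hanti (Nat.zero_le k))⟩
    · rintro ⟨h1, h2⟩
      have hex : ∃ k, (invBranch γ)^[k] z < x :=
        ((tendsto_invBranch_iterate hγ hz).eventually_lt_const h1).exists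
      obtain ⟨k, hk⟩ : ∃ k, Nat.find hex = k + 1 := Nat.exists_eq_succ_of_ne_zero fun h0 => by
        have := Nat.find_spec hex
        rw [h0] at this
        exact absurd this (not_lt.2 h2)
      refine ⟨k, hk ▸ Nat.find_spec hex, not_lt.1 (Nat.find_min hex (by omega))⟩
  rw [← hU, lintegral_iUnion (fun k => measurableSet_Ioc)]
  exact hanti.pairwise_disjoint_on_Ioc_succ

end Branch

/-! ### Transfer operators on nonincreasing functions -/

section Transfer

/-- Part of the transfer operator coming from the left branch. -/
def leftTransfer (γ : ℝ) (u : ℝ → ℝ≥0∞) (x : ℝ) : ℝ≥0∞ :=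
  ENNReal.ofReal (invDeriv γ x) * u (invBranch γ x)

/-- Part of the transfer operator coming from the right branch. -/
def rightTransfer (u : ℝ → ℝ≥0∞) (x : ℝ) : ℝ≥0∞ := 2⁻¹ * u ((x + 1) / 2)

/-- The transfer operator of the intermittent map with respect to Lebesgue measure. -/
def transfer (γ : ℝ) (u : ℝ → ℝ≥0∞) (x : ℝ) : ℝ≥0∞ := leftTransfer γ u x + rightTransfer u x

/-- The sum of all iterates of `leftTransfer`. -/
def leftPotential (γ : ℝ) (v : ℝ → ℝ≥0∞) (x : ℝ) : ℝ≥0∞ :=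
  ∑' k, ENNReal.ofReal (iterDeriv γ k x) * v ((invBranch γ)^[k] x)

/-- The transfer operator of the map induced on the right half, transported to the unit interval. -/
def inducedTransfer (γ : ℝ) (v : ℝ → ℝ≥0∞) : ℝ → ℝ≥0∞ := rightTransfer (leftPotential γ v)

variable {γ : ℝ} {v : ℝ → ℝ≥0∞}

lemma antitone_leftPotential (hγ : 0 < γ) (hv : Antitone v) : Antitone (leftPotential γ v) :=
  fun _ _ hxy => ENNReal.tsum_le_tsum fun k => mul_le_mul'
    (ENNReal.ofReal_le_ofReal (antitone_iterDeriv hγ k hxy))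
    (hv ((strictMono_invBranch hγ).monotone.iterate k hxy))

lemma antitone_rightTransfer (hv : Antitone v) : Antitone (rightTransfer v) :=
  fun _ _ hxy => mul_le_mul' le_rfl (hv (by linarith))

lemma antitone_inducedTransfer (hγ : 0 < γ) (hv : Antitone v) : Antitone (inducedTransfer γ v) :=
  antitone_rightTransfer (antitone_leftPotential hγ hv)

lemma leftPotential_eq (hγ : 0 < γ) (v : ℝ → ℝ≥0∞) (x : ℝ) :
    leftPotential γ v x = v x + leftTransfer γ (leftPotential γ v) x := by
  rw [leftPotential, tsum_eq_zero_add' ENNReal.summable, leftTransfer, leftPotential,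
    ← ENNReal.tsum_mul_left]
  congr 1
  · simp [iterDeriv]
  · refine tsum_congr fun k => ?_
    rw [iterDeriv_succ, ENNReal.ofReal_mul (invDeriv_pos hγ x).le, mul_assoc,
      Function.iterate_succ_apply]

lemma leftPotential_mono {v w : ℝ → ℝ≥0∞} (h : ∀ x, v x ≤ w x) (x : ℝ) :
    leftPotential γ v x ≤ leftPotential γ w x :=
  ENNReal.tsum_le_tsum fun _ => mul_le_mul' le_rfl (h _)

lemma inducedTransfer_tsum (w : ℕ → ℝ → ℝ≥0∞) (x : ℝ) :
    inducedTransfer γ (fun y => ∑' n, w n y) x = ∑' n, inducedTransfer γ (w n) x := by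
  simp only [inducedTransfer, rightTransfer, leftPotential, ← ENNReal.tsum_mul_left]
  exact ENNReal.tsum_comm

lemma setLIntegral_half (F : ℝ → ℝ≥0∞) :
    ∫⁻ x in Set.Ioc (0 : ℝ) 1, 2⁻¹ * F ((x + 1) / 2) = ∫⁻ x in Set.Ioc (1 / 2 : ℝ) 1, F x := by
  have him : (fun x : ℝ => (x + 1) / 2) '' Set.Ioc 0 1 = Set.Ioc (1 / 2 : ℝ) 1 := by
    ext y
    constructor
    · rintro ⟨x, ⟨h1, h2⟩, rfl⟩
      constructor <;> simp only <;> linarith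
    · rintro ⟨h1, h2⟩
      exact ⟨2 * y - 1, ⟨by linarith, by linarith⟩, by ring⟩
  have hd : ∀ x ∈ Set.Ioc (0 : ℝ) 1,
      HasDerivWithinAt (fun x : ℝ => (x + 1) / 2) (1 / 2) (Set.Ioc 0 1) x := fun x _ =>
    (((hasDerivAt_id' x).add_const 1).div_const 2).hasDerivWithinAt
  rw [← him, lintegral_image_eq_lintegral_abs_deriv_mul measurableSet_Ioc hd
    (fun x _ y _ h => by simpa using h)]
  congr 1 with x
  congr 1
  rw [abs_of_pos (by norm_num), one_div, ENNReal.ofReal_inv_of_pos zero_lt_two]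
  norm_num

lemma setLIntegral_inducedTransfer (hγ : 0 < γ) (hv : Measurable v) :
    ∫⁻ x in Set.Ioc (0 : ℝ) 1, inducedTransfer γ v x = ∫⁻ x in Set.Ioc (0 : ℝ) 1, v x := by
  simp only [inducedTransfer, rightTransfer]
  rw [setLIntegral_half]
  simp only [leftPotential]
  have hm : ∀ k, Measurable fun x => ENNReal.ofReal (iterDeriv γ k x) * v ((invBranch γ)^[k] x) :=
    fun k => (ENNReal.measurable_ofReal.comp (antitone_iterDeriv hγ k).measurable).mul
      (hv.comp ((continuous_invBranch hγ).iterate k).measurable)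
  rw [lintegral_tsum fun k => (hm k).aemeasurable,
    ← tsum_setLIntegral_iterate hγ one_pos]
  refine tsum_congr fun k => ?_
  rw [setLIntegral_iterDeriv_mul hγ k (by norm_num), Function.iterate_succ_apply,
    invBranch_one hγ]

lemma mul_leftPotential_le (hγ : 0 < γ) (hv : Antitone v) {z : ℝ} (hz : 0 < z) :
    ENNReal.ofReal (z - invBranch γ z) * leftPotential γ v z ≤ ∫⁻ x in Set.Ioc 0 z, v x := by
  rw [← tsum_setLIntegral_iterate hγ hz, leftPotential, ← ENNReal.tsum_mul_left]
  refine ENNReal.tsum_le_tsum fun k => ?_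
  have hz' := invBranch_lt_self hγ hz
  rw [← mul_assoc, ← ENNReal.ofReal_mul (sub_pos.2 hz').le]
  calc _ ≤ ENNReal.ofReal ((invBranch γ)^[k] z - (invBranch γ)^[k + 1] z)
        * v ((invBranch γ)^[k] z) := by
        gcongr
        exact le_iterate_sub hγ k (invBranch_pos hγ hz) hz'
    _ = ∫⁻ x in Set.Ioc ((invBranch γ)^[k + 1] z) ((invBranch γ)^[k] z),
          v ((invBranch γ)^[k] z) := by
        rw [setLIntegral_const, Real.volume_Ioc, mul_comm]
    _ ≤ _ := setLIntegral_mono' measurableSet_Ioc fun x hx => hv hx.2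

lemma le_mul_leftPotential (hγ : 0 < γ) (hv : Antitone v) {z : ℝ} (hz : 0 < z) :
    ENNReal.ofReal (invDeriv γ z) * ∫⁻ x in Set.Ioc 0 z, v x
      ≤ ENNReal.ofReal (z - invBranch γ z) * leftPotential γ v z := by
  have hz' := invBranch_lt_self hγ hz
  have h1 : ∫⁻ x in Set.Ioc 0 z, v x ≤ ENNReal.ofReal (z - invBranch γ z)
      * leftPotential γ v (invBranch γ z) := by
    rw [← tsum_setLIntegral_iterate hγ hz, leftPotential, ← ENNReal.tsum_mul_left]
    refine ENNReal.tsum_le_tsum fun k => ?_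
    rw [← mul_assoc, ← ENNReal.ofReal_mul (sub_pos.2 hz').le]
    calc _ ≤ ∫⁻ x in Set.Ioc ((invBranch γ)^[k + 1] z) ((invBranch γ)^[k] z),
            v ((invBranch γ)^[k + 1] z) :=
          setLIntegral_mono' measurableSet_Ioc fun x hx => hv hx.1.le
      _ = ENNReal.ofReal ((invBranch γ)^[k] z - (invBranch γ)^[k + 1] z)
          * v ((invBranch γ)^[k + 1] z) := by
          rw [setLIntegral_const, Real.volume_Ioc, mul_comm]
      _ ≤ _ := by
          rw [Function.iterate_succ_apply]
          gcongr
          exact iterate_sub_le hγ k (invBranch_pos hγ hz) hz'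
  calc _ ≤ ENNReal.ofReal (invDeriv γ z) * (ENNReal.ofReal (z - invBranch γ z)
      * leftPotential γ v (invBranch γ z)) := by gcongr
    _ = ENNReal.ofReal (z - invBranch γ z) * leftTransfer γ (leftPotential γ v) z := by
        rw [leftTransfer]; ring
    _ ≤ _ := by
        gcongr
        rw [leftPotential_eq hγ v z]
        exact le_add_self

lemma inducedTransfer_le (hγ : 0 < γ) (hγ' : γ < 1 / 2) (hv : Antitone v) {x : ℝ} (hx : 0 ≤ x)
    (hx1 : x ≤ 1) : inducedTransfer γ v x ≤ 4 * ∫⁻ y in Set.Ioc (0 : ℝ) 1, v y := by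
  set z := (x + 1) / 2 with hz
  have hz0 : 1 / 2 ≤ z := by rw [hz]; linarith
  have hz1 : z ≤ 1 := by rw [hz]; linarith
  have hzp : 0 < z := by linarith
  have h8 : 1 / 8 ≤ z - invBranch γ z := by
    rw [sub_invBranch hγ hzp]
    have h1 : 1 / 4 ≤ invBranch γ z := by linarith [half_le_invBranch hγ hzp hz1]
    have h2 : (1 / 2 : ℝ) ≤ (2 * invBranch γ z) ^ γ := by
      calc (1 / 2 : ℝ) = (1 / 2) ^ (1 : ℝ) := by simp
        _ ≤ (1 / 2) ^ γ := Real.rpow_le_rpow_of_exponent_ge (by norm_num) (by norm_num)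
            (by linarith)
        _ ≤ _ := Real.rpow_le_rpow (by norm_num) (by linarith) hγ.le
    nlinarith
  have h := mul_leftPotential_le hγ hv hzp
  have h3 : ENNReal.ofReal (1 / 8) * leftPotential γ v z ≤ ∫⁻ y in Set.Ioc (0 : ℝ) 1, v y := by
    refine (mul_le_mul' (ENNReal.ofReal_le_ofReal h8) le_rfl).trans (h.trans ?_)
    exact lintegral_mono_set (Set.Ioc_subset_Ioc_right hz1)
  calc inducedTransfer γ v x = 2⁻¹ * leftPotential γ v z := rfl
    _ = 4 * (ENNReal.ofReal (1 / 8) * leftPotential γ v z) := by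
        rw [← mul_assoc]
        congr 1
        rw [show (4 : ℝ≥0∞) = ENNReal.ofReal 4 by simp, ← ENNReal.ofReal_mul (by norm_num),
          show (2 : ℝ≥0∞)⁻¹ = ENNReal.ofReal 2⁻¹ by
            rw [ENNReal.ofReal_inv_of_pos zero_lt_two]; simp]
        norm_num
    _ ≤ _ := by gcongr

lemma le_inducedTransfer (hγ : 0 < γ) (hγ' : γ < 1 / 2) (hv : Antitone v) {x : ℝ}
    (hx1 : x ≤ 1) :
    ENNReal.ofReal (2 / 5) * ∫⁻ y in Set.Ioc (0 : ℝ) 1, v y ≤ inducedTransfer γ v x := by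
  have h := le_mul_leftPotential hγ hv one_pos
  have e : ENNReal.ofReal (1 - invBranch γ 1) = 2⁻¹ := by
    rw [invBranch_one hγ]
    norm_num
    rw [ENNReal.ofReal_div_of_pos zero_lt_two]
    simp
  rw [e] at h
  calc _ ≤ ENNReal.ofReal (invDeriv γ 1) * ∫⁻ y in Set.Ioc (0 : ℝ) 1, v y := by
        gcongr; exact two_fifths_le_invDeriv hγ hγ' le_rfl
    _ ≤ 2⁻¹ * leftPotential γ v 1 := h
    _ ≤ 2⁻¹ * leftPotential γ v ((x + 1) / 2) := by
        gcongr; exact antitone_leftPotential hγ hv (by linarith)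

lemma setLIntegral_rpow {s : ℝ} (hs : s < 1) (C : ℝ) {z : ℝ} (hz : 0 < z) :
    ∫⁻ x in Set.Ioc 0 z, ENNReal.ofReal (C * x ^ (-s))
      = ENNReal.ofReal (C * (z ^ (1 - s) / (1 - s))) := by
  rcases le_or_gt C 0 with hC | hC
  · rw [ENNReal.ofReal_of_nonpos (mul_nonpos_of_nonpos_of_nonneg hC
      (div_nonneg (by positivity) (by linarith)))]
    refine (setLIntegral_congr_fun (g := fun _ => 0) measurableSet_Ioc fun x hx => ?_).trans
      (by simp)
    exact ENNReal.ofReal_of_nonpos (mul_nonpos_of_nonpos_of_nonneg hC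
      (Real.rpow_nonneg hx.1.le _))
  · have hi : IntervalIntegrable (fun x : ℝ => x ^ (-s)) volume 0 z :=
      intervalIntegral.intervalIntegrable_rpow' (by linarith)
    rw [← ofReal_integral_eq_lintegral_ofReal]
    · rw [integral_const_mul, ← intervalIntegral.integral_of_le hz.le,
        integral_rpow (Or.inl (by linarith)), Real.zero_rpow (by linarith)]
      congr 3
      · rw [sub_zero]; congr 1; ring
      · ring
    · exact ((intervalIntegrable_iff_integrableOn_Ioc_of_le hz.le).1 hi).const_mul C
    · refine (ae_restrict_mem measurableSet_Ioc).mono fun x hx => ?_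
      exact mul_nonneg hC.le (Real.rpow_nonneg hx.1.le _)

lemma leftPotential_le_rpow (hγ : 0 < γ) (hv : Antitone v) {s C : ℝ} (hs : s < 1)
    (h : ∀ x ∈ Set.Ioc (0 : ℝ) 1, v x ≤ ENNReal.ofReal (C * x ^ (-s))) {z : ℝ}
    (hz : 0 < z) (hz1 : z ≤ 1) :
    leftPotential γ v z ≤ ENNReal.ofReal (2 * C / (1 - s) * z ^ (-(s + γ))) := by
  have h1 := mul_leftPotential_le hγ hv hz
  have h2 : ∫⁻ x in Set.Ioc 0 z, v x ≤ ENNReal.ofReal (C * (z ^ (1 - s) / (1 - s))) := by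
    rw [← setLIntegral_rpow hs C hz]
    exact setLIntegral_mono' measurableSet_Ioc fun x hx => h x ⟨hx.1, hx.2.trans hz1⟩
  have h3 : z / 2 * z ^ γ ≤ z - invBranch γ z := by
    rw [sub_invBranch hγ hz]
    have := half_le_invBranch hγ hz hz1
    have h0 := invBranch_pos hγ hz
    gcongr
    linarith
  have h4 : 0 < z / 2 * z ^ γ := by positivity
  have h5 : ENNReal.ofReal (z / 2 * z ^ γ) * leftPotential γ v z
      ≤ ENNReal.ofReal (C * (z ^ (1 - s) / (1 - s))) :=
    (mul_le_mul' (ENNReal.ofReal_le_ofReal h3) le_rfl).trans (h1.trans h2)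
  rw [mul_comm, ← ENNReal.le_div_iff_mul_le (Or.inl (ENNReal.ofReal_pos.2 h4).ne')
    (Or.inl ENNReal.ofReal_ne_top), ← ENNReal.ofReal_div_of_pos h4] at h5
  refine h5.trans_eq ?_
  congr 1
  have e1 : z ^ (1 - s) = z * z ^ γ * z ^ (-(s + γ)) := by
    nth_rw 2 [← Real.rpow_one z]
    rw [← Real.rpow_add hz, ← Real.rpow_add hz]
    congr 1; ring
  have hs' : 1 - s ≠ 0 := by linarith
  rw [e1]
  field_simp

lemma rpow_le_leftPotential_one (hγ : 0 < γ) (hγ' : γ < 1 / 2) {z : ℝ} (hz : 0 < z)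
    (hz1 : z ≤ 1) :
    ENNReal.ofReal (1 / 5 * z ^ (-γ)) ≤ leftPotential γ (fun _ => 1) z := by
  have h1 := le_mul_leftPotential hγ (v := fun _ => 1) antitone_const hz
  rw [setLIntegral_const, Real.volume_Ioc, one_mul, sub_zero,
    ← ENNReal.ofReal_mul (invDeriv_pos hγ z).le] at h1
  have h2 : z - invBranch γ z ≤ 2 * z * z ^ γ := by
    rw [sub_invBranch hγ hz]
    have h0 := invBranch_pos hγ hz
    have h3 := (invBranch_lt_self hγ hz).le
    calc _ ≤ z * (2 * z) ^ γ := by gcongr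
      _ = z * (2 ^ γ * z ^ γ) := by rw [Real.mul_rpow zero_le_two hz.le]
      _ ≤ z * (2 * z ^ γ) := by
          gcongr
          exact Real.rpow_le_self_of_one_le one_le_two (by linarith)
      _ = _ := by ring
  have h3 : ENNReal.ofReal (2 / 5 * z) ≤ ENNReal.ofReal (2 * z * z ^ γ)
      * leftPotential γ (fun _ => 1) z := by
    refine le_trans ?_ (h1.trans (mul_le_mul' (ENNReal.ofReal_le_ofReal h2) le_rfl))
    refine ENNReal.ofReal_le_ofReal ?_
    gcongr
    exact two_fifths_le_invDeriv hγ hγ' hz1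
  have h4 : 0 < 2 * z * z ^ γ := by positivity
  rw [mul_comm (ENNReal.ofReal (2 * z * z ^ γ)),
    ← ENNReal.div_le_iff_le_mul (Or.inl (ENNReal.ofReal_pos.2 h4).ne')
    (Or.inl ENNReal.ofReal_ne_top), ← ENNReal.ofReal_div_of_pos h4] at h3
  refine le_trans (le_of_eq ?_) h3
  congr 1
  rw [Real.rpow_neg hz.le]
  field_simp

end Transfer

/-! ### Solving the Poisson equation on nonincreasing functions -/

section Poisson

/-- The successive remainders of `g` under the induced transfer operator, a multiple of the
constant function being removed at each step. -/
def renewalTerm (γ : ℝ) (g : ℝ → ℝ≥0∞) : ℕ → ℝ → ℝ≥0∞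
  | 0 => g
  | n + 1 => fun x => inducedTransfer γ (renewalTerm γ g n) x
      - ENNReal.ofReal (2 / 5) * ∫⁻ y in Set.Ioc (0 : ℝ) 1, renewalTerm γ g n y

/-- A nonincreasing `u` with `transfer γ u + g = u + ∫ g` on the unit interval. -/
def poissonSolution (γ : ℝ) (g : ℝ → ℝ≥0∞) : ℝ → ℝ≥0∞ :=
  leftPotential γ fun x => ∑' n, renewalTerm γ g n x

variable {γ : ℝ} {g : ℝ → ℝ≥0∞}

lemma antitone_renewalTerm (hγ : 0 < γ) (hg : Antitone g) : ∀ n, Antitone (renewalTerm γ g n)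
  | 0 => hg
  | n + 1 => fun _ _ hxy =>
    tsub_le_tsub_right (antitone_inducedTransfer hγ (antitone_renewalTerm hγ hg n) hxy) _

lemma setLIntegral_renewalTerm (hγ : 0 < γ) (hγ' : γ < 1 / 2) (hg : Antitone g)
    (hfin : ∫⁻ x in Set.Ioc (0 : ℝ) 1, g x ≠ ∞) (n : ℕ) :
    ∫⁻ x in Set.Ioc (0 : ℝ) 1, renewalTerm γ g n x
      = ENNReal.ofReal (3 / 5) ^ n * ∫⁻ x in Set.Ioc (0 : ℝ) 1, g x := by
  induction n with
  | zero => simp [renewalTerm]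
  | succ n ih =>
    have hn := antitone_renewalTerm hγ hg n
    have hm : ∫⁻ x in Set.Ioc (0 : ℝ) 1, renewalTerm γ g n x ≠ ∞ := by
      rw [ih]; exact ENNReal.mul_ne_top (ENNReal.pow_ne_top ENNReal.ofReal_ne_top) hfin
    simp only [renewalTerm]
    rw [lintegral_sub measurable_const]
    · rw [setLIntegral_inducedTransfer hγ hn.measurable, setLIntegral_const, Real.volume_Ioc,
        pow_succ', mul_assoc (ENNReal.ofReal (3 / 5)), ← ih]
      refine ENNReal.sub_eq_of_eq_add
        (ENNReal.mul_ne_top (ENNReal.mul_ne_top ENNReal.ofReal_ne_top hm) (by simp)) ?_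
      rw [sub_zero, ENNReal.ofReal_one, mul_one, ← add_mul, ← ENNReal.ofReal_add (by norm_num)
        (by norm_num)]
      norm_num
    · rw [setLIntegral_const]
      exact ENNReal.mul_ne_top (ENNReal.mul_ne_top ENNReal.ofReal_ne_top hm) (by simp)
    · exact (ae_restrict_mem measurableSet_Ioc).mono fun x hx => le_inducedTransfer hγ hγ' hn hx.2

lemma tsum_ofReal_three_fifths_pow : ∑' n, ENNReal.ofReal (3 / 5) ^ n = ENNReal.ofReal (5 / 2) := by
  rw [ENNReal.tsum_geometric, ← ENNReal.ofReal_one, ← ENNReal.ofReal_sub _ (by norm_num),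
    ← ENNReal.ofReal_inv_of_pos (by norm_num)]
  norm_num

lemma tsum_renewalTerm_le (hγ : 0 < γ) (hγ' : γ < 1 / 2) (hg : Antitone g)
    (hfin : ∫⁻ x in Set.Ioc (0 : ℝ) 1, g x ≠ ∞) {x : ℝ} (hx : 0 ≤ x) (hx1 : x ≤ 1) :
    ∑' n, renewalTerm γ g n x ≤ g x + 10 * ∫⁻ x in Set.Ioc (0 : ℝ) 1, g x := by
  rw [tsum_eq_zero_add' ENNReal.summable]
  refine add_le_add le_rfl ?_
  calc ∑' n, renewalTerm γ g (n + 1) x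
      ≤ ∑' n, 4 * (ENNReal.ofReal (3 / 5) ^ n * ∫⁻ x in Set.Ioc (0 : ℝ) 1, g x) := by
        refine ENNReal.tsum_le_tsum fun n => ?_
        rw [← setLIntegral_renewalTerm hγ hγ' hg hfin n]
        exact tsub_le_self.trans
          (inducedTransfer_le hγ hγ' (antitone_renewalTerm hγ hg n) hx hx1)
    _ = _ := by
        rw [ENNReal.tsum_mul_left, ENNReal.tsum_mul_right, tsum_ofReal_three_fifths_pow,
          ← mul_assoc]
        congr 1
        rw [show (4 : ℝ≥0∞) = ENNReal.ofReal 4 by simp, ← ENNReal.ofReal_mul (by norm_num)]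
        norm_num

lemma inducedTransfer_tsum_renewalTerm (hγ : 0 < γ) (hγ' : γ < 1 / 2) (hg : Antitone g)
    (hfin : ∫⁻ x in Set.Ioc (0 : ℝ) 1, g x ≠ ∞) {x : ℝ} (hx1 : x ≤ 1) :
    inducedTransfer γ (fun x => ∑' n, renewalTerm γ g n x) x + g x
      = ∑' n, renewalTerm γ g n x + ∫⁻ x in Set.Ioc (0 : ℝ) 1, g x := by
  have h1 : ∀ n, inducedTransfer γ (renewalTerm γ g n) x = renewalTerm γ g (n + 1) x
      + ENNReal.ofReal (2 / 5) * (ENNReal.ofReal (3 / 5) ^ n * ∫⁻ x in Set.Ioc (0 : ℝ) 1, g x) := by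
    intro n
    rw [← setLIntegral_renewalTerm hγ hγ' hg hfin n]
    exact (tsub_add_cancel_of_le
      (le_inducedTransfer hγ hγ' (antitone_renewalTerm hγ hg n) hx1)).symm
  rw [inducedTransfer_tsum, tsum_congr h1, ENNReal.tsum_add, ENNReal.tsum_mul_left,
    ENNReal.tsum_mul_right, tsum_ofReal_three_fifths_pow, ← mul_assoc,
    ← ENNReal.ofReal_mul (by norm_num), tsum_eq_zero_add' (f := fun n => renewalTerm γ g n x)
      ENNReal.summable]
  norm_num [renewalTerm]
  ring

lemma antitone_poissonSolution (hγ : 0 < γ) (hg : Antitone g) : Antitone (poissonSolution γ g) :=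
  antitone_leftPotential hγ fun _ _ hxy =>
    ENNReal.tsum_le_tsum fun n => antitone_renewalTerm hγ hg n hxy

lemma transfer_poissonSolution (hγ : 0 < γ) (hγ' : γ < 1 / 2) (hg : Antitone g)
    (hfin : ∫⁻ x in Set.Ioc (0 : ℝ) 1, g x ≠ ∞) {x : ℝ} (hx1 : x ≤ 1) :
    transfer γ (poissonSolution γ g) x + g x
      = poissonSolution γ g x + ∫⁻ x in Set.Ioc (0 : ℝ) 1, g x := by
  have h := inducedTransfer_tsum_renewalTerm hγ hγ' hg hfin hx1
  rw [transfer, add_assoc]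
  change leftTransfer γ (poissonSolution γ g) x
    + (inducedTransfer γ (fun x => ∑' n, renewalTerm γ g n x) x + g x) = _
  rw [h, poissonSolution, leftPotential_eq hγ _ x]
  ring

lemma leftPotential_le_poissonSolution (x : ℝ) : leftPotential γ g x ≤ poissonSolution γ g x :=
  leftPotential_mono (fun y => ENNReal.le_tsum (f := fun n => renewalTerm γ g n y) 0) x

lemma setLIntegral_ne_top_of_le_rpow {s C : ℝ} (hs : s < 1)
    (h : ∀ x ∈ Set.Ioc (0 : ℝ) 1, g x ≤ ENNReal.ofReal (C * x ^ (-s))) :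
    ∫⁻ x in Set.Ioc (0 : ℝ) 1, g x ≠ ∞ := by
  refine ((setLIntegral_mono' measurableSet_Ioc h).trans_lt ?_).ne
  rw [setLIntegral_rpow hs C one_pos]
  exact ENNReal.ofReal_lt_top

lemma poissonSolution_le_rpow (hγ : 0 < γ) (hγ' : γ < 1 / 2) (hg : Antitone g) {s C : ℝ}
    (hs0 : 0 ≤ s) (hs : s < 1) (hC : 0 ≤ C)
    (h : ∀ x ∈ Set.Ioc (0 : ℝ) 1, g x ≤ ENNReal.ofReal (C * x ^ (-s))) :
    ∃ K, 0 ≤ K ∧ ∀ x ∈ Set.Ioc (0 : ℝ) 1,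
      poissonSolution γ g x ≤ ENNReal.ofReal (K * x ^ (-(s + γ))) := by
  have hfin := setLIntegral_ne_top_of_le_rpow hs h
  set M := (∫⁻ x in Set.Ioc (0 : ℝ) 1, g x).toReal with hM
  have hM0 : 0 ≤ M := ENNReal.toReal_nonneg
  refine ⟨2 * (C + 10 * M) / (1 - s), div_nonneg (by positivity) (by linarith), fun x hx =>
    leftPotential_le_rpow hγ (fun _ _ hxy => ENNReal.tsum_le_tsum fun n =>
      antitone_renewalTerm hγ hg n hxy) hs (fun y hy => ?_) hx.1 hx.2⟩
  refine (tsum_renewalTerm_le hγ hγ' hg hfin hy.1.le hy.2).trans ?_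
  have h1 : 1 ≤ y ^ (-s) := Real.one_le_rpow_of_pos_of_le_one_of_nonpos hy.1 hy.2 (by linarith)
  calc _ ≤ ENNReal.ofReal (C * y ^ (-s)) + ENNReal.ofReal (10 * M) := by
        refine add_le_add (h y hy) (le_of_eq ?_)
        rw [ENNReal.ofReal_mul (by norm_num), hM, ENNReal.ofReal_toReal hfin]
        norm_num
    _ ≤ _ := by
        rw [← ENNReal.ofReal_add (by positivity) (by positivity)]
        refine ENNReal.ofReal_le_ofReal ?_
        nlinarith

end Poisson

/-! ### The invariant measure -/

section InvMeasure

variable {γ : ℝ}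

lemma measurable_Tmap : Measurable (Tmap γ) := by
  refine Measurable.ite measurableSet_Iio ?_ ?_ <;> fun_prop

lemma Tmap_of_lt_half {x : ℝ} (hx0 : 0 ≤ x) (hx : x < 1 / 2) : Tmap γ x = leftBranch γ x := by
  rw [Tmap, if_pos hx, leftBranch_of_nonneg hx0]

lemma Tmap_of_half_le {x : ℝ} (hx : 1 / 2 ≤ x) : Tmap γ x = 2 * x - 1 := by
  rw [Tmap, if_neg (not_lt.2 hx)]

lemma measurable_transfer (hγ : 0 < γ) {u : ℝ → ℝ≥0∞} (hu : Measurable u) :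
    Measurable (transfer γ u) := by
  refine Measurable.add ?_ ?_
  · exact (ENNReal.measurable_ofReal.comp (antitone_invDeriv hγ).measurable).mul
      (hu.comp (continuous_invBranch hγ).measurable)
  · exact (hu.comp (by fun_prop : Measurable fun x : ℝ => (x + 1) / 2)).const_mul _

lemma setLIntegral_mul_transfer (hγ : 0 < γ) {u φ : ℝ → ℝ≥0∞} (hu : Measurable u)
    (hφ : Measurable φ) :
    ∫⁻ x in Set.Ioc (0 : ℝ) 1, φ x * transfer γ u x
      = ∫⁻ x in Set.Ioc (0 : ℝ) 1, φ (Tmap γ x) * u x := by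
  have hl : ∫⁻ x in Set.Ioc (0 : ℝ) 1, φ x * leftTransfer γ u x
      = ∫⁻ x in Set.Ioc (0 : ℝ) (1 / 2), φ (Tmap γ x) * u x := by
    have h := setLIntegral_iterDeriv_mul hγ 1 (b := 1) le_rfl fun y => φ (leftBranch γ y) * u y
    simp only [Function.iterate_one, leftBranch_invBranch hγ, invBranch_zero hγ, invBranch_one hγ]
      at h
    refine Eq.trans ?_ (h.trans ?_)
    · refine lintegral_congr fun x => ?_
      rw [leftTransfer, iterDeriv]
      simp
      ring
    · rw [← setLIntegral_congr Ioo_ae_eq_Ioc, ← setLIntegral_congr Ioo_ae_eq_Ioc]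
      exact setLIntegral_congr_fun measurableSet_Ioo fun x hx => by
        rw [Tmap_of_lt_half hx.1.le hx.2]
  have hr : ∫⁻ x in Set.Ioc (0 : ℝ) 1, φ x * rightTransfer u x
      = ∫⁻ x in Set.Ioc (1 / 2 : ℝ) 1, φ (Tmap γ x) * u x := by
    have h := setLIntegral_half fun y => φ (2 * y - 1) * u y
    refine Eq.trans ?_ (h.trans ?_)
    · refine lintegral_congr fun x => ?_
      rw [rightTransfer, show 2 * ((x + 1) / 2) - 1 = x by ring]
      ring
    · exact setLIntegral_congr_fun measurableSet_Ioc fun x hx => by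
        rw [Tmap_of_half_le hx.1.le]
  have hm : Measurable fun x => φ x * rightTransfer u x :=
    hφ.mul ((hu.comp (by fun_prop : Measurable fun x : ℝ => (x + 1) / 2)).const_mul _)
  simp only [transfer, mul_add]
  rw [lintegral_add_right _ hm, hl, hr, ← lintegral_union measurableSet_Ioc
    (Set.Ioc_disjoint_Ioc_of_le le_rfl), Set.Ioc_union_Ioc_eq_Ioc (by norm_num) (by norm_num)]

/-- The density of the invariant probability measure of the intermittent map. -/
def invDensity (γ : ℝ) (x : ℝ) : ℝ≥0∞ :=
  (∫⁻ y in Set.Ioc (0 : ℝ) 1, poissonSolution γ (fun _ => 1) y)⁻¹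
    * poissonSolution γ (fun _ => 1) x

/-- The invariant probability measure of the intermittent map. -/
def invMeasure (γ : ℝ) : Measure ℝ :=
  (volume.restrict (Set.Ioc (0 : ℝ) 1)).withDensity (invDensity γ)

lemma antitone_invDensity (hγ : 0 < γ) : Antitone (invDensity γ) := fun _ _ hxy =>
  mul_le_mul' le_rfl (antitone_poissonSolution hγ antitone_const hxy)

lemma exists_poissonSolution_one_le (hγ : 0 < γ) (hγ' : γ < 1 / 2) : ∃ K, 0 ≤ K ∧
    ∀ x ∈ Set.Ioc (0 : ℝ) 1, poissonSolution γ (fun _ => 1) x ≤ ENNReal.ofReal (K * x ^ (-γ)) := by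
  simpa using poissonSolution_le_rpow hγ hγ' (g := fun _ => 1) antitone_const le_rfl one_pos
    zero_le_one (by simp)

lemma lintegral_poissonSolution_one_ne_top (hγ : 0 < γ) (hγ' : γ < 1 / 2) :
    ∫⁻ y in Set.Ioc (0 : ℝ) 1, poissonSolution γ (fun _ => 1) y ≠ ∞ := by
  obtain ⟨K, -, hK⟩ := exists_poissonSolution_one_le hγ hγ'
  exact setLIntegral_ne_top_of_le_rpow (by linarith) hK

lemma le_poissonSolution_one (hγ : 0 < γ) (hγ' : γ < 1 / 2) {x : ℝ} (hx : x ∈ Set.Ioc (0 : ℝ) 1) :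
    ENNReal.ofReal (1 / 5 * x ^ (-γ)) ≤ poissonSolution γ (fun _ => 1) x :=
  (rpow_le_leftPotential_one hγ hγ' hx.1 hx.2).trans (leftPotential_le_poissonSolution x)

lemma lintegral_poissonSolution_one_ne_zero (hγ : 0 < γ) (hγ' : γ < 1 / 2) :
    ∫⁻ y in Set.Ioc (0 : ℝ) 1, poissonSolution γ (fun _ => 1) y ≠ 0 := by
  refine (lt_of_lt_of_le ?_ (setLIntegral_mono' measurableSet_Ioc fun x hx =>
    le_poissonSolution_one hγ hγ' hx)).ne'
  rw [setLIntegral_rpow (by linarith) _ one_pos, ENNReal.ofReal_pos]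
  have : 0 < 1 - γ := by linarith
  positivity

lemma exists_invDensity_le (hγ : 0 < γ) (hγ' : γ < 1 / 2) : ∃ K, 0 < K ∧
    ∀ x ∈ Set.Ioc (0 : ℝ) 1, invDensity γ x ≤ ENNReal.ofReal (K * x ^ (-γ)) := by
  obtain ⟨K, hK0, hK⟩ := exists_poissonSolution_one_le hγ hγ'
  have hZ := ENNReal.inv_ne_top.2 (lintegral_poissonSolution_one_ne_zero hγ hγ')
  set Z := (∫⁻ y in Set.Ioc (0 : ℝ) 1, poissonSolution γ (fun _ => 1) y)⁻¹ with hZd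
  refine ⟨Z.toReal * K + 1, by positivity, fun x hx => ?_⟩
  calc invDensity γ x ≤ Z * ENNReal.ofReal (K * x ^ (-γ)) := mul_le_mul' le_rfl (hK x hx)
    _ = ENNReal.ofReal (Z.toReal * (K * x ^ (-γ))) := by
        rw [ENNReal.ofReal_mul ENNReal.toReal_nonneg, ENNReal.ofReal_toReal hZ]
    _ ≤ _ := by
        refine ENNReal.ofReal_le_ofReal ?_
        have := Real.rpow_nonneg hx.1.le (-γ)
        nlinarith

lemma exists_le_invDensity (hγ : 0 < γ) (hγ' : γ < 1 / 2) : ∃ κ, 0 < κ ∧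
    ∀ x ∈ Set.Ioc (0 : ℝ) 1, ENNReal.ofReal (κ * x ^ (-γ)) ≤ invDensity γ x := by
  have hZ := ENNReal.inv_ne_top.2 (lintegral_poissonSolution_one_ne_zero hγ hγ')
  have hZ0 := ENNReal.inv_ne_zero.2 (lintegral_poissonSolution_one_ne_top hγ hγ')
  set Z := (∫⁻ y in Set.Ioc (0 : ℝ) 1, poissonSolution γ (fun _ => 1) y)⁻¹ with hZd
  refine ⟨Z.toReal * (1 / 5), mul_pos (ENNReal.toReal_pos hZ0 hZ) (by norm_num), fun x hx => ?_⟩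
  rw [mul_assoc, ENNReal.ofReal_mul ENNReal.toReal_nonneg, ENNReal.ofReal_toReal hZ]
  exact mul_le_mul' le_rfl (le_poissonSolution_one hγ hγ' hx)

lemma transfer_invDensity (hγ : 0 < γ) (hγ' : γ < 1 / 2) {x : ℝ} (hx : x ≤ 1) :
    transfer γ (invDensity γ) x = invDensity γ x := by
  have h := transfer_poissonSolution hγ hγ' (g := fun _ => 1) antitone_const (by simp) hx
  simp only [lintegral_const, MeasurableSet.univ, Measure.restrict_apply, Set.univ_inter,
    Real.volume_Ioc, sub_zero, ENNReal.ofReal_one, mul_one] at h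
  rw [ENNReal.add_left_inj ENNReal.one_ne_top] at h
  rw [invDensity, ← h]
  simp only [transfer, leftTransfer, rightTransfer, invDensity]
  ring

lemma isProbabilityMeasure_invMeasure (hγ : 0 < γ) (hγ' : γ < 1 / 2) :
    IsProbabilityMeasure (invMeasure γ) := by
  refine ⟨?_⟩
  rw [invMeasure, withDensity_apply _ MeasurableSet.univ, Measure.restrict_univ]
  simp only [invDensity]
  rw [lintegral_const_mul _ (antitone_poissonSolution hγ antitone_const).measurable,
    ENNReal.inv_mul_cancel (lintegral_poissonSolution_one_ne_zero hγ hγ')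
      (lintegral_poissonSolution_one_ne_top hγ hγ')]

lemma lintegral_invMeasure (hγ : 0 < γ) {φ : ℝ → ℝ≥0∞} (hφ : Measurable φ) :
    ∫⁻ x, φ x ∂invMeasure γ = ∫⁻ x in Set.Ioc (0 : ℝ) 1, φ x * invDensity γ x := by
  rw [invMeasure, lintegral_withDensity_eq_lintegral_mul _ (antitone_invDensity hγ).measurable hφ]
  simp only [Pi.mul_apply, mul_comm]

lemma measurePreserving_invMeasure (hγ : 0 < γ) (hγ' : γ < 1 / 2) :
    MeasurePreserving (Tmap γ) (invMeasure γ) (invMeasure γ) := by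
  refine ⟨measurable_Tmap, Measure.ext_of_lintegral _ fun φ hφ => ?_⟩
  rw [lintegral_map hφ measurable_Tmap,
    lintegral_invMeasure hγ (φ := fun x => φ (Tmap γ x)) (hφ.comp measurable_Tmap),
    lintegral_invMeasure hγ hφ,
    ← setLIntegral_mul_transfer hγ (antitone_invDensity hγ).measurable hφ]
  exact setLIntegral_congr_fun measurableSet_Ioc fun x hx => by
    simp only [transfer_invDensity hγ hγ' hx.2]

lemma ae_mem_Ioc_invMeasure : ∀ᵐ x ∂invMeasure γ, x ∈ Set.Ioc (0 : ℝ) 1 :=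
  (withDensity_absolutelyContinuous _ _).ae_le (ae_restrict_mem measurableSet_Ioc)

lemma invDensity_ne_top (hγ : 0 < γ) (hγ' : γ < 1 / 2) {x : ℝ} (hx : x ∈ Set.Ioc (0 : ℝ) 1) :
    invDensity γ x ≠ ∞ := by
  obtain ⟨K, -, hK⟩ := exists_invDensity_le hγ hγ'
  exact ((hK x hx).trans_lt ENNReal.ofReal_lt_top).ne

lemma invDensity_ne_zero (hγ : 0 < γ) (hγ' : γ < 1 / 2) {x : ℝ} (hx : x ∈ Set.Ioc (0 : ℝ) 1) :
    invDensity γ x ≠ 0 := by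
  obtain ⟨κ, hκ, h⟩ := exists_le_invDensity hγ hγ'
  refine (lt_of_lt_of_le (ENNReal.ofReal_pos.2 ?_) (h x hx)).ne'
  have := Real.rpow_pos_of_pos hx.1 (-γ)
  positivity

end InvMeasure

/-! ### Correctors -/

section Corrector

variable {γ : ℝ}

/-- The density with respect to the invariant measure of the measure with Lebesgue density `u`. -/
def relDensity (γ : ℝ) (u : ℝ → ℝ≥0∞) (x : ℝ) : ℝ := (u x / invDensity γ x).toReal

/-- The reversed martingale difference attached to the Lebesgue density `u`. -/
def corrector (γ : ℝ) (u : ℝ → ℝ≥0∞) (x : ℝ) : ℝ :=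
  relDensity γ u x - relDensity γ (transfer γ u) (Tmap γ x)

lemma measurable_relDensity (hγ : 0 < γ) {u : ℝ → ℝ≥0∞} (hu : Measurable u) :
    Measurable (relDensity γ u) :=
  (hu.div (antitone_invDensity hγ).measurable).ennreal_toReal

lemma measurable_corrector (hγ : 0 < γ) {u : ℝ → ℝ≥0∞} (hu : Measurable u) :
    Measurable (corrector γ u) :=
  (measurable_relDensity hγ hu).sub
    ((measurable_relDensity hγ (measurable_transfer hγ hu)).comp measurable_Tmap)

lemma setLIntegral_div_invDensity (hγ : 0 < γ) (hγ' : γ < 1 / 2) {u : ℝ → ℝ≥0∞}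
    (hu : Measurable u) {A : Set ℝ} (hA : MeasurableSet A) :
    ∫⁻ x in A, u x / invDensity γ x ∂invMeasure γ
      = ∫⁻ x in Set.Ioc (0 : ℝ) 1, A.indicator 1 x * u x := by
  rw [← lintegral_indicator hA, lintegral_invMeasure hγ
    (φ := A.indicator fun x => u x / invDensity γ x)
    ((hu.div (antitone_invDensity hγ).measurable).indicator hA)]
  refine setLIntegral_congr_fun measurableSet_Ioc fun x hx => ?_
  by_cases hxA : x ∈ A
  · simp only [Set.indicator_of_mem hxA, Pi.one_apply, one_mul]
    exact ENNReal.div_mul_cancel (invDensity_ne_zero hγ hγ' hx) (invDensity_ne_top hγ hγ' hx)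
  · simp [Set.indicator_of_notMem hxA]

lemma lintegral_transfer (hγ : 0 < γ) {u : ℝ → ℝ≥0∞} (hu : Measurable u) :
    ∫⁻ x in Set.Ioc (0 : ℝ) 1, transfer γ u x = ∫⁻ x in Set.Ioc (0 : ℝ) 1, u x := by
  simpa using setLIntegral_mul_transfer hγ hu (φ := fun _ => 1) measurable_const

lemma lintegral_div_invDensity_ne_top (hγ : 0 < γ) (hγ' : γ < 1 / 2) {u : ℝ → ℝ≥0∞}
    (hu : Measurable u) (hfin : ∫⁻ x in Set.Ioc (0 : ℝ) 1, u x ≠ ∞) :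
    ∫⁻ x, u x / invDensity γ x ∂invMeasure γ ≠ ∞ := by
  rw [← setLIntegral_univ, setLIntegral_div_invDensity hγ hγ' hu MeasurableSet.univ]
  simpa using hfin

lemma integrable_relDensity (hγ : 0 < γ) (hγ' : γ < 1 / 2) {u : ℝ → ℝ≥0∞}
    (hu : Measurable u) (hfin : ∫⁻ x in Set.Ioc (0 : ℝ) 1, u x ≠ ∞) :
    Integrable (relDensity γ u) (invMeasure γ) :=
  integrable_toReal_of_lintegral_ne_top (hu.div (antitone_invDensity hγ).measurable).aemeasurable
    (lintegral_div_invDensity_ne_top hγ hγ' hu hfin)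

lemma setIntegral_relDensity (hγ : 0 < γ) (hγ' : γ < 1 / 2) {u : ℝ → ℝ≥0∞}
    (hu : Measurable u) (hfin : ∫⁻ x in Set.Ioc (0 : ℝ) 1, u x ≠ ∞) {A : Set ℝ}
    (hA : MeasurableSet A) :
    ∫ x in A, relDensity γ u x ∂invMeasure γ
      = (∫⁻ x in Set.Ioc (0 : ℝ) 1, A.indicator 1 x * u x).toReal := by
  have hm := hu.div (antitone_invDensity hγ).measurable
  rw [← setLIntegral_div_invDensity hγ hγ' hu hA]
  exact integral_toReal hm.aemeasurable (ae_restrict_of_ae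
    (ae_lt_top hm (lintegral_div_invDensity_ne_top hγ hγ' hu hfin)))

lemma isReversedDiff_corrector (hγ : 0 < γ) (hγ' : γ < 1 / 2) {u : ℝ → ℝ≥0∞}
    (hu : Measurable u) (hfin : ∫⁻ x in Set.Ioc (0 : ℝ) 1, u x ≠ ∞) :
    IsReversedDiff (invMeasure γ) (Tmap γ) (corrector γ u) := by
  have hT := measurePreserving_invMeasure hγ hγ'
  have hu' := measurable_transfer hγ hu
  have hfin' : ∫⁻ x in Set.Ioc (0 : ℝ) 1, transfer γ u x ≠ ∞ := by
    rwa [lintegral_transfer hγ hu]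
  have h1 := integrable_relDensity hγ hγ' hu hfin
  have h2 := integrable_relDensity hγ hγ' hu' hfin'
  have h3 : Integrable (fun x => relDensity γ (transfer γ u) (Tmap γ x)) (invMeasure γ) :=
    (hT.integrable_comp h2.aestronglyMeasurable).2 h2
  have h6 : Integrable (corrector γ u) (invMeasure γ) := h1.sub h3
  refine ⟨h6, fun A hA => ?_⟩
  have h4 : ∫ x in Tmap γ ⁻¹' A, relDensity γ (transfer γ u) (Tmap γ x) ∂invMeasure γ
      = ∫ x in A, relDensity γ (transfer γ u) x ∂invMeasure γ := by
    conv_rhs => rw [← hT.map_eq]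
    exact (setIntegral_map hA (by rw [hT.map_eq]; exact h2.aestronglyMeasurable)
      measurable_Tmap.aemeasurable).symm
  have h5 : ∀ x, (Tmap γ ⁻¹' A).indicator (1 : ℝ → ℝ≥0∞) x = A.indicator 1 (Tmap γ x) :=
    fun x => rfl
  have h7 : ∫ x in Tmap γ ⁻¹' A, corrector γ u x ∂invMeasure γ
      = ∫ x in Tmap γ ⁻¹' A, relDensity γ u x ∂invMeasure γ
        - ∫ x in Tmap γ ⁻¹' A, relDensity γ (transfer γ u) (Tmap γ x) ∂invMeasure γ :=
    integral_sub h1.integrableOn h3.integrableOn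
  rw [h7, h4, setIntegral_relDensity hγ hγ' hu hfin (measurable_Tmap hA),
    setIntegral_relDensity hγ hγ' hu' hfin' hA,
    setLIntegral_mul_transfer hγ hu (measurable_one.indicator hA), sub_eq_zero]
  simp only [h5]

end Corrector

/-! ### Square integrability of correctors -/

section Square

variable {γ : ℝ} {u : ℝ → ℝ≥0∞} {s K : ℝ}

lemma toReal_rpow_le {F : ℝ → ℝ≥0∞} {K b : ℝ} (hK : 0 ≤ K)
    (h : ∀ x ∈ Set.Ioc (0 : ℝ) 1, F x ≤ ENNReal.ofReal (K * x ^ (-b))) {x : ℝ}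
    (hx : x ∈ Set.Ioc (0 : ℝ) 1) : (F x).toReal ≤ K * x ^ (-b) :=
  ENNReal.toReal_le_of_le_ofReal (mul_nonneg hK (Real.rpow_nonneg hx.1.le _)) (h x hx)

lemma exists_le_toReal_invDensity (hγ : 0 < γ) (hγ' : γ < 1 / 2) : ∃ κ, 0 < κ ∧
    ∀ x ∈ Set.Ioc (0 : ℝ) 1, κ * x ^ (-γ) ≤ (invDensity γ x).toReal := by
  obtain ⟨κ, hκ, h⟩ := exists_le_invDensity hγ hγ'
  exact ⟨κ, hκ, fun x hx => (ENNReal.ofReal_le_iff_le_toReal (invDensity_ne_top hγ hγ' hx)).1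
    (h x hx)⟩

lemma toReal_invDensity_pos (hγ : 0 < γ) (hγ' : γ < 1 / 2) {x : ℝ} (hx : x ∈ Set.Ioc (0 : ℝ) 1) :
    0 < (invDensity γ x).toReal :=
  ENNReal.toReal_pos (invDensity_ne_zero hγ hγ' hx) (invDensity_ne_top hγ hγ' hx)

lemma invBranch_mem_Ioc (hγ : 0 < γ) {x : ℝ} (hx : x ∈ Set.Ioc (0 : ℝ) 1) :
    invBranch γ x ∈ Set.Ioc (0 : ℝ) 1 :=
  ⟨invBranch_pos hγ hx.1, (invBranch_lt_self hγ hx.1).le.trans hx.2⟩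

lemma half_add_mem_Ioc {x : ℝ} (hx : x ∈ Set.Ioc (0 : ℝ) 1) :
    (x + 1) / 2 ∈ Set.Ioc (0 : ℝ) 1 :=
  ⟨by linarith [hx.1], by linarith [hx.2]⟩

lemma toReal_transfer (hγ : 0 < γ) (hu : ∀ x ∈ Set.Ioc (0 : ℝ) 1, u x ≠ ∞) {z : ℝ}
    (hz : z ∈ Set.Ioc (0 : ℝ) 1) :
    (transfer γ u z).toReal = invDeriv γ z * (u (invBranch γ z)).toReal
      + 1 / 2 * (u ((z + 1) / 2)).toReal := by
  rw [transfer, leftTransfer, rightTransfer, ENNReal.toReal_add, ENNReal.toReal_mul,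
    ENNReal.toReal_mul, ENNReal.toReal_ofReal (invDeriv_pos hγ z).le]
  · norm_num
  · exact ENNReal.mul_ne_top ENNReal.ofReal_ne_top (hu _ (invBranch_mem_Ioc hγ hz))
  · exact ENNReal.mul_ne_top (by simp) (hu _ (half_add_mem_Ioc hz))

lemma abs_sub_div_le {D Ux Uy Rx Ry Rz : ℝ} (hUx : 0 ≤ Ux) (hUy : 0 ≤ Uy) (hRx : 0 < Rx)
    (hRy : 0 < Ry) (hRz : 0 < Rz) (h : Rz = D * Rx + 1 / 2 * Ry) :
    |Ux / Rx - (D * Ux + 1 / 2 * Uy) / Rz| ≤ (Ux / Rx * Ry + Uy) / Rz := by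
  have e : Ux / Rx - (D * Ux + 1 / 2 * Uy) / Rz = (1 / 2 * (Ux / Rx * Ry) - 1 / 2 * Uy) / Rz := by
    have : Ux = Ux / Rx * Rx := by field_simp
    rw [eq_div_iff hRz.ne', sub_mul, div_mul_cancel₀ _ hRz.ne', h]
    nth_rw 2 [this]
    ring
  have h0 : 0 ≤ Ux / Rx * Ry := by positivity
  rw [e, abs_div, abs_of_pos hRz]
  gcongr
  rw [abs_le]
  constructor <;> linarith

lemma relDensity_le {κ : ℝ} (hκ : 0 < κ)
    (hκ' : ∀ x ∈ Set.Ioc (0 : ℝ) 1, κ * x ^ (-γ) ≤ (invDensity γ x).toReal) (hK : 0 ≤ K)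
    (h : ∀ x ∈ Set.Ioc (0 : ℝ) 1, u x ≤ ENNReal.ofReal (K * x ^ (-(s + 2 * γ)))) {x : ℝ}
    (hx : x ∈ Set.Ioc (0 : ℝ) 1) : relDensity γ u x ≤ K / κ * x ^ (-(s + γ)) := by
  have h1 : 0 < x ^ (-γ) := Real.rpow_pos_of_pos hx.1 _
  rw [relDensity, ENNReal.toReal_div]
  calc _ ≤ K * x ^ (-(s + 2 * γ)) / (κ * x ^ (-γ)) :=
        div_le_div₀ (mul_nonneg hK (Real.rpow_nonneg hx.1.le _)) (toReal_rpow_le hK h hx)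
          (by positivity) (hκ' x hx)
    _ = _ := by
        rw [show -(s + 2 * γ) = -(s + γ) + -γ by ring, Real.rpow_add hx.1]
        field_simp

lemma ne_top_of_le_ofReal {F : ℝ → ℝ≥0∞} {k : ℝ → ℝ} {S : Set ℝ}
    (h : ∀ x ∈ S, F x ≤ ENNReal.ofReal (k x)) : ∀ x ∈ S, F x ≠ ∞ :=
  fun x hx => ((h x hx).trans_lt ENNReal.ofReal_lt_top).ne

lemma exists_abs_corrector_le_left (hγ : 0 < γ) (hγ' : γ < 1 / 2) (hu : Antitone u) (hs : 0 ≤ s)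
    (hK : 0 ≤ K)
    (h : ∀ x ∈ Set.Ioc (0 : ℝ) 1, u x ≤ ENNReal.ofReal (K * x ^ (-(s + 2 * γ)))) :
    ∃ A, 0 ≤ A ∧ ∀ x ∈ Set.Ioo (0 : ℝ) (1 / 2), |corrector γ u x| ≤ A * x ^ (-s) := by
  obtain ⟨κ, hκ, hκ'⟩ := exists_le_toReal_invDensity hγ hγ'
  have htop := ne_top_of_le_ofReal h
  have hhalf : (1 / 2 : ℝ) ∈ Set.Ioc (0 : ℝ) 1 := by norm_num
  set M₁ := (invDensity γ (1 / 2)).toReal with hM₁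
  set M₂ := (u (1 / 2)).toReal with hM₂
  have hM₁0 : 0 ≤ M₁ := ENNReal.toReal_nonneg
  have hM₂0 : 0 ≤ M₂ := ENNReal.toReal_nonneg
  refine ⟨(K / κ * M₁ + M₂) * (2 / κ), by positivity, fun x hx => ?_⟩
  have hx1 : x ∈ Set.Ioc (0 : ℝ) 1 := ⟨hx.1, by linarith [hx.2]⟩
  set z := Tmap γ x with hz
  have hzx : z = leftBranch γ x := Tmap_of_lt_half hx.1.le hx.2
  have hψ : invBranch γ z = x := by rw [hzx, invBranch_leftBranch hγ]
  have hz2 : z ≤ 2 * x := by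
    rw [hzx, leftBranch_eq_add hx.1.le]
    have : (2 * x) ^ γ ≤ 1 := Real.rpow_le_one (by linarith [hx.1]) (by linarith [hx.2]) hγ.le
    nlinarith [hx.1]
  have hz0 : 0 < z := by
    rw [hzx, leftBranch_eq_add hx.1.le]
    have := hx.1
    positivity
  have hz1 : z ∈ Set.Ioc (0 : ℝ) 1 := ⟨hz0, by linarith [hx.2]⟩
  have hy := half_add_mem_Ioc hz1
  have hyh : 1 / 2 ≤ (z + 1) / 2 := by linarith
  have hRz := toReal_invDensity_pos hγ hγ' hz1
  have hD := toReal_transfer hγ (fun x hx => invDensity_ne_top hγ hγ' hx) hz1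
  rw [transfer_invDensity hγ hγ' hz1.2, hψ] at hD
  have h1 := abs_sub_div_le (Ux := (u x).toReal) (Uy := (u ((z + 1) / 2)).toReal)
    ENNReal.toReal_nonneg ENNReal.toReal_nonneg (toReal_invDensity_pos hγ hγ' hx1)
    (toReal_invDensity_pos hγ hγ' hy) hRz hD
  have h2 : corrector γ u x = (u x).toReal / (invDensity γ x).toReal
      - (invDeriv γ z * (u x).toReal + 1 / 2 * (u ((z + 1) / 2)).toReal)
        / (invDensity γ z).toReal := by
    rw [corrector, relDensity, relDensity, ENNReal.toReal_div, ENNReal.toReal_div,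
      toReal_transfer hγ htop hz1, hψ]
  have h3 := relDensity_le hκ hκ' hK h hx1
  rw [relDensity, ENNReal.toReal_div] at h3
  have h4 : (invDensity γ ((z + 1) / 2)).toReal ≤ M₁ := ENNReal.toReal_mono
    (invDensity_ne_top hγ hγ' hhalf) (antitone_invDensity hγ hyh)
  have h5 : (u ((z + 1) / 2)).toReal ≤ M₂ * x ^ (-(s + γ)) :=
    (ENNReal.toReal_mono (htop _ hhalf) (hu hyh)).trans (le_mul_of_one_le_right hM₂0
      (Real.one_le_rpow_of_pos_of_le_one_of_nonpos hx1.1 hx1.2 (by linarith)))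
  have h6 : ((invDensity γ z).toReal)⁻¹ ≤ 2 / κ * x ^ γ := by
    calc _ ≤ (κ * z ^ (-γ))⁻¹ := inv_anti₀ (by positivity) (hκ' z hz1)
      _ = z ^ γ / κ := by rw [Real.rpow_neg hz0.le]; field_simp
      _ ≤ (2 * x) ^ γ / κ := by gcongr
      _ = 2 ^ γ / κ * x ^ γ := by rw [Real.mul_rpow zero_le_two hx.1.le]; ring
      _ ≤ _ := by
        have := hx.1
        gcongr
        exact Real.rpow_le_self_of_one_le one_le_two (by linarith)
  rw [h2]
  refine h1.trans ?_
  rw [div_eq_mul_inv]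
  have hx0 := hx.1
  calc _ ≤ (K / κ * x ^ (-(s + γ)) * M₁ + M₂ * x ^ (-(s + γ))) * (2 / κ * x ^ γ) := by gcongr
    _ = (K / κ * M₁ + M₂) * (2 / κ) * (x ^ (-(s + γ)) * x ^ γ) := by ring
    _ = _ := by
      rw [← Real.rpow_add hx.1]
      congr 2
      ring

lemma exists_abs_corrector_le_right (hγ : 0 < γ) (hγ' : γ < 1 / 2) (hu : Antitone u) (hs : 0 ≤ s)
    (hK : 0 ≤ K)
    (h : ∀ x ∈ Set.Ioc (0 : ℝ) 1, u x ≤ ENNReal.ofReal (K * x ^ (-(s + 2 * γ)))) :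
    ∃ A, 0 ≤ A ∧ ∀ x ∈ Set.Ioc (1 / 2 : ℝ) 1,
      |corrector γ u x| ≤ A * (2 * x - 1) ^ (-(s + γ)) := by
  obtain ⟨κ, hκ, hκ'⟩ := exists_le_toReal_invDensity hγ hγ'
  have htop := ne_top_of_le_ofReal h
  refine ⟨K / κ * 2 ^ (s + γ) + 2 * K * 2 ^ (s + 2 * γ) / κ, by positivity, fun x hx => ?_⟩
  have hx1 : x ∈ Set.Ioc (0 : ℝ) 1 := ⟨by linarith [hx.1], hx.2⟩
  set z := 2 * x - 1 with hz
  have hz1 : z ∈ Set.Ioc (0 : ℝ) 1 := ⟨by linarith [hx.1], by linarith [hx.2]⟩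
  have hz0 := hz1.1
  have h3 : relDensity γ u x ≤ K / κ * 2 ^ (s + γ) * z ^ (-(s + γ)) := by
    calc _ ≤ K / κ * x ^ (-(s + γ)) := relDensity_le hκ hκ' hK h hx1
      _ ≤ K / κ * (z / 2) ^ (-(s + γ)) := mul_le_mul_of_nonneg_left
        (Real.rpow_le_rpow_of_nonpos (by positivity) (by linarith) (by linarith)) (by positivity)
      _ = _ := by
        rw [Real.div_rpow hz0.le zero_le_two, Real.rpow_neg zero_le_two]
        field_simp
  have h4 : relDensity γ (transfer γ u) z
      ≤ 2 * K * 2 ^ (s + 2 * γ) / κ * z ^ (-(s + γ)) := by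
    have hψ := half_le_invBranch hγ hz1.1 hz1.2
    have hψ1 := invBranch_mem_Ioc hγ hz1
    have h5 : (u (invBranch γ z)).toReal ≤ K * (z / 2) ^ (-(s + 2 * γ)) :=
      (toReal_rpow_le hK h hψ1).trans (mul_le_mul_of_nonneg_left
        (Real.rpow_le_rpow_of_nonpos (by positivity) hψ (by linarith)) hK)
    have h6 : (u ((z + 1) / 2)).toReal ≤ (u (invBranch γ z)).toReal :=
      ENNReal.toReal_mono (htop _ hψ1)
        (hu ((invBranch_le_half hγ hz1.2).trans (by linarith)))
    have h7 : (0 : ℝ) ≤ (u (invBranch γ z)).toReal := ENNReal.toReal_nonneg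
    have h8 : (transfer γ u z).toReal ≤ 2 * (K * (z / 2) ^ (-(s + 2 * γ))) := by
      rw [toReal_transfer hγ htop hz1]
      have := invDeriv_le_one hγ z
      have := mul_le_mul_of_nonneg_right this h7
      linarith
    have h9 : 0 < z ^ (-γ) := Real.rpow_pos_of_pos hz0 _
    rw [relDensity, ENNReal.toReal_div]
    calc _ ≤ 2 * (K * (z / 2) ^ (-(s + 2 * γ))) / (κ * z ^ (-γ)) :=
          div_le_div₀ (by positivity) h8 (by positivity) (hκ' z hz1)
      _ = _ := by
        rw [Real.div_rpow hz0.le zero_le_two, Real.rpow_neg zero_le_two,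
          show -(s + 2 * γ) = -(s + γ) + -γ by ring, Real.rpow_add hz0]
        field_simp
  have h10 : 0 ≤ relDensity γ u x := ENNReal.toReal_nonneg
  have h11 : 0 ≤ relDensity γ (transfer γ u) z := ENNReal.toReal_nonneg
  rw [corrector, Tmap_of_half_le hx.1.le, add_mul, abs_le]
  constructor <;> linarith

end Square

section Square

variable {γ : ℝ} {u : ℝ → ℝ≥0∞} {s K : ℝ}

lemma memLp_corrector (hγ : 0 < γ) (hu : Antitone u) (hs : 0 ≤ s) (hsγ : s < 1 / 2 - γ)
    (hK : 0 ≤ K)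
    (h : ∀ x ∈ Set.Ioc (0 : ℝ) 1, u x ≤ ENNReal.ofReal (K * x ^ (-(s + 2 * γ)))) :
    MemLp (corrector γ u) 2 (invMeasure γ) := by
  have hγ' : γ < 1 / 2 := by linarith
  have hm := measurable_corrector hγ hu.measurable
  obtain ⟨A, hA, hAx⟩ := exists_abs_corrector_le_left hγ hγ' hu hs hK h
  obtain ⟨B, hB, hBx⟩ := exists_abs_corrector_le_right hγ hγ' hu hs hK h
  obtain ⟨L, hL, hLx⟩ := exists_invDensity_le hγ hγ'
  rw [memLp_two_iff_integrable_sq hm.aestronglyMeasurable]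
  refine ⟨(hm.pow_const 2).aestronglyMeasurable, ?_⟩
  rw [hasFiniteIntegral_iff_ofReal (ae_of_all _ fun x => sq_nonneg _),
    lintegral_invMeasure hγ (hm.pow_const 2).ennreal_ofReal,
    ← Set.Ioc_union_Ioc_eq_Ioc (a := (0 : ℝ)) (b := 1 / 2) (c := 1) (by norm_num) (by norm_num)]
  refine (lintegral_union_le _ _ _).trans_lt (ENNReal.add_lt_top.2 ⟨?_, ?_⟩)
  · rw [← setLIntegral_congr Ioo_ae_eq_Ioc]
    refine (setLIntegral_mono' (g := fun x => ENNReal.ofReal (A ^ 2 * L * x ^ (-(2 * s + γ))))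
      measurableSet_Ioo fun x hx => ?_).trans_lt ?_
    · have hx0 := hx.1
      calc _ ≤ ENNReal.ofReal ((A * x ^ (-s)) ^ 2) * ENNReal.ofReal (L * x ^ (-γ)) := by
            refine mul_le_mul' (ENNReal.ofReal_le_ofReal ?_)
              (hLx x ⟨hx.1, by linarith [hx.2]⟩)
            rw [← sq_abs]
            exact pow_le_pow_left₀ (abs_nonneg _) (hAx x hx) 2
        _ = _ := by
            rw [← ENNReal.ofReal_mul (by positivity)]
            congr 1
            rw [show -(2 * s + γ) = -s + -s + -γ by ring, Real.rpow_add hx0, Real.rpow_add hx0]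
            ring
    · rw [setLIntegral_congr Ioo_ae_eq_Ioc, setLIntegral_rpow (by linarith) _ (by norm_num)]
      exact ENNReal.ofReal_lt_top
  · have hhalf : (1 / 2 : ℝ) ∈ Set.Ioc (0 : ℝ) 1 := by norm_num
    refine (setLIntegral_mono' (g := fun x => ENNReal.ofReal
      (B ^ 2 * (2 * x - 1) ^ (-(2 * (s + γ)))) * invDensity γ (1 / 2))
      measurableSet_Ioc fun x hx => ?_).trans_lt ?_
    · refine mul_le_mul' (ENNReal.ofReal_le_ofReal ?_) (antitone_invDensity hγ hx.1.le)
      have h0 : 0 < 2 * x - 1 := by linarith [hx.1]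
      rw [← sq_abs]
      calc _ ≤ (B * (2 * x - 1) ^ (-(s + γ))) ^ 2 :=
            pow_le_pow_left₀ (abs_nonneg _) (hBx x hx) 2
        _ = _ := by
            rw [show -(2 * (s + γ)) = -(s + γ) + -(s + γ) by ring, Real.rpow_add h0]
            ring
    · have e := setLIntegral_half fun x => ENNReal.ofReal
        (B ^ 2 * (2 * x - 1) ^ (-(2 * (s + γ)))) * invDensity γ (1 / 2)
      rw [← e]
      have e2 : ∀ x : ℝ, 2 * ((x + 1) / 2) - 1 = x := fun x => by ring
      simp only [e2]
      rw [lintegral_const_mul' _ _ (by simp), lintegral_mul_const' _ _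
        (invDensity_ne_top hγ hγ' hhalf), setLIntegral_rpow (by linarith) _ one_pos]
      exact ENNReal.mul_lt_top (by simp) (ENNReal.mul_lt_top ENNReal.ofReal_lt_top
        (invDensity_ne_top hγ hγ' hhalf).lt_top)

end Square

/-! ### Coboundary decomposition of nonincreasing observables -/

section Coboundary

variable {γ : ℝ}

lemma lintegral_invDensity (hγ : 0 < γ) (hγ' : γ < 1 / 2) :
    ∫⁻ x in Set.Ioc (0 : ℝ) 1, invDensity γ x = 1 := by
  have := isProbabilityMeasure_invMeasure hγ hγ'
  have h := lintegral_invMeasure hγ (φ := fun _ => 1) measurable_const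
  simpa using h.symm

lemma relDensity_poissonSolution (hγ : 0 < γ) (hγ' : γ < 1 / 2) {G : ℝ → ℝ≥0∞} (hG : Antitone G)
    {s K : ℝ} (hs : s < 1) (hGK : ∀ x ∈ Set.Ioc (0 : ℝ) 1, G x ≤ ENNReal.ofReal (K * x ^ (-s)))
    {x : ℝ} (hx : x ∈ Set.Ioc (0 : ℝ) 1) (hu : poissonSolution γ G x ≠ ∞) :
    relDensity γ (transfer γ (poissonSolution γ G)) x + relDensity γ G x
      = relDensity γ (poissonSolution γ G) x
        + (∫⁻ y in Set.Ioc (0 : ℝ) 1, G y).toReal / (invDensity γ x).toReal := by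
  have hfin := setLIntegral_ne_top_of_le_rpow hs hGK
  have h := transfer_poissonSolution hγ hγ' hG hfin hx.2
  have h1 : transfer γ (poissonSolution γ G) x + G x ≠ ∞ := by
    rw [h]; exact ENNReal.add_ne_top.2 ⟨hu, hfin⟩
  rw [ENNReal.add_ne_top] at h1
  have h2 := congrArg ENNReal.toReal h
  rw [ENNReal.toReal_add h1.1 h1.2, ENNReal.toReal_add hu hfin] at h2
  simp only [relDensity, ENNReal.toReal_div]
  rw [← add_div, ← add_div, h2]

lemma exists_coboundary (hγ : 0 < γ) {F : ℝ → ℝ≥0∞} (hF : Antitone F) {s C : ℝ} (hs : 0 ≤ s)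
    (hsγ : s < 1 / 2 - γ) (hC : 0 ≤ C)
    (hFC : ∀ x ∈ Set.Ioc (0 : ℝ) 1, F x ≤ ENNReal.ofReal (C * x ^ (-s))) :
    ∃ m h : ℝ → ℝ, Measurable m ∧ Measurable h ∧ IsReversedDiff (invMeasure γ) (Tmap γ) m ∧
      MemLp m 2 (invMeasure γ) ∧
      ∀ x, (F x).toReal - ∫ y, (F y).toReal ∂invMeasure γ = m x + (h (Tmap γ x) - h x) := by
  have hγ' : γ < 1 / 2 := by linarith
  have hr := antitone_invDensity hγ
  obtain ⟨L, hL, hLx⟩ := exists_invDensity_le hγ hγ'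
  set c := ∫⁻ x in Set.Ioc (0 : ℝ) 1, F x * invDensity γ x with hc
  have hG₁ : Antitone fun x => F x * invDensity γ x := fun _ _ hxy => mul_le_mul' (hF hxy) (hr hxy)
  have hG₂ : Antitone fun x => c * invDensity γ x := fun _ _ hxy => mul_le_mul' le_rfl (hr hxy)
  have hb₁ : ∀ x ∈ Set.Ioc (0 : ℝ) 1,
      F x * invDensity γ x ≤ ENNReal.ofReal (C * L * x ^ (-(s + γ))) := by
    intro x hx
    refine (mul_le_mul' (hFC x hx) (hLx x hx)).trans_eq ?_
    rw [← ENNReal.ofReal_mul (mul_nonneg hC (Real.rpow_nonneg hx.1.le _)), neg_add,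
      Real.rpow_add hx.1]
    congr 1
    ring
  have hcfin : c ≠ ∞ := setLIntegral_ne_top_of_le_rpow (by linarith) hb₁
  have hb₂ : ∀ x ∈ Set.Ioc (0 : ℝ) 1,
      c * invDensity γ x ≤ ENNReal.ofReal (c.toReal * L * x ^ (-γ)) := by
    intro x hx
    rw [mul_assoc, ENNReal.ofReal_mul ENNReal.toReal_nonneg, ENNReal.ofReal_toReal hcfin]
    exact mul_le_mul' le_rfl (hLx x hx)
  have hc₂ : ∫⁻ x in Set.Ioc (0 : ℝ) 1, c * invDensity γ x = c := by
    rw [lintegral_const_mul' _ _ hcfin, lintegral_invDensity hγ hγ', mul_one]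
  set u₁ := poissonSolution γ fun x => F x * invDensity γ x with hu₁
  set u₂ := poissonSolution γ fun x => c * invDensity γ x with hu₂
  have ha₁ : Antitone u₁ := antitone_poissonSolution hγ hG₁
  have ha₂ : Antitone u₂ := antitone_poissonSolution hγ hG₂
  obtain ⟨K₁, hK₁, hKx₁⟩ := poissonSolution_le_rpow hγ hγ' hG₁ (by linarith) (by linarith)
    (by positivity) hb₁
  obtain ⟨K₂, hK₂, hKx₂⟩ := poissonSolution_le_rpow hγ hγ' hG₂ hγ.le (by linarith)
    (by positivity) hb₂
  replace hKx₁ : ∀ x ∈ Set.Ioc (0 : ℝ) 1, u₁ x ≤ ENNReal.ofReal (K₁ * x ^ (-(s + 2 * γ))) :=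
    fun x hx => (hKx₁ x hx).trans_eq (by rw [two_mul, add_assoc])
  replace hKx₂ : ∀ x ∈ Set.Ioc (0 : ℝ) 1, u₂ x ≤ ENNReal.ofReal (K₂ * x ^ (-(0 + 2 * γ))) :=
    fun x hx => (hKx₂ x hx).trans_eq (by rw [two_mul, zero_add])
  have hint : ∫ y, (F y).toReal ∂invMeasure γ = c.toReal := by
    have h := lintegral_invMeasure hγ hF.measurable
    rw [hc, ← h]
    refine integral_toReal hF.measurable.aemeasurable (ae_lt_top hF.measurable ?_)
    rwa [h]
  set w : ℝ → ℝ := fun x => relDensity γ u₁ x - relDensity γ u₂ x with hw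
  set h : ℝ → ℝ := fun x => w x - ((F x).toReal - c.toReal) with hh
  have hwm : Measurable w :=
    (measurable_relDensity hγ ha₁.measurable).sub (measurable_relDensity hγ ha₂.measurable)
  have hhm : Measurable h := hwm.sub (hF.measurable.ennreal_toReal.sub_const _)
  have hhT : ∀ x ∈ Set.Ioc (0 : ℝ) 1,
      h x = relDensity γ (transfer γ u₁) x - relDensity γ (transfer γ u₂) x := by
    intro x hx
    have e₁ := relDensity_poissonSolution hγ hγ' hG₁ (by linarith) hb₁ hx
      (ne_top_of_le_ofReal hKx₁ x hx)
    have e₂ := relDensity_poissonSolution hγ hγ' hG₂ (by linarith) hb₂ hx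
      (ne_top_of_le_ofReal hKx₂ x hx)
    rw [hc₂] at e₂
    have hR := toReal_invDensity_pos hγ hγ' hx
    have d₁ : relDensity γ (fun x => F x * invDensity γ x) x = (F x).toReal := by
      rw [relDensity, ENNReal.toReal_div, ENNReal.toReal_mul, mul_div_cancel_right₀ _ hR.ne']
    have d₂ : relDensity γ (fun x => c * invDensity γ x) x = c.toReal := by
      rw [relDensity, ENNReal.toReal_div, ENNReal.toReal_mul, mul_div_cancel_right₀ _ hR.ne']
    rw [d₁] at e₁
    rw [d₂] at e₂
    simp only [hh, hw]
    linarith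
  have hmae : (fun x => corrector γ u₁ x - corrector γ u₂ x)
      =ᵐ[invMeasure γ] fun x => w x - h (Tmap γ x) := by
    filter_upwards [(measurePreserving_invMeasure hγ hγ').quasiMeasurePreserving.ae
      ae_mem_Ioc_invMeasure] with x hx
    rw [hhT _ hx]
    simp only [corrector, hw]
    ring
  refine ⟨fun x => w x - h (Tmap γ x), h, hwm.sub (hhm.comp measurable_Tmap), hhm, ?_, ?_, ?_⟩
  · exact ((isReversedDiff_corrector hγ hγ' ha₁.measurable
      (setLIntegral_ne_top_of_le_rpow (by linarith) hKx₁)).sub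
      (isReversedDiff_corrector hγ hγ' ha₂.measurable
      (setLIntegral_ne_top_of_le_rpow (by linarith) hKx₂))).congr_ae hmae
  · exact ((memLp_corrector hγ ha₁ hs hsγ hK₁ hKx₁).sub
      (memLp_corrector hγ ha₂ le_rfl (by linarith) hK₂ hKx₂)).ae_eq hmae
  · intro x
    rw [hint]
    simp only [hh]
    ring

end Coboundary

/-! ### Ergodicity and uniqueness of the invariant measure -/

section Uniqueness

lemma MeanErgodic.measureReal_eq {Ω : Type*} [MeasurableSpace Ω] {μ ν : Measure Ω} {T : Ω → Ω}
    [IsProbabilityMeasure μ] [IsProbabilityMeasure ν] (hT : MeasurePreserving T μ μ)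
    (hT' : MeasurePreserving T ν ν) (hν : ν ≪ μ) {A : Set Ω} (hA : MeasurableSet A)
    (h : MeanErgodic μ T (A.indicator fun _ => 1)) : ν.real A = μ.real A := by
  set φ : Ω → ℝ := A.indicator fun _ => 1 with hφ
  have hφm : Measurable φ := measurable_const.indicator hA
  have hφ0 : ∀ x, 0 ≤ φ x := Set.indicator_nonneg fun _ _ => zero_le_one
  have hφ1 : ∀ x, φ x ≤ 1 := Set.indicator_le_self' fun _ _ => zero_le_one
  have hi : ∀ (κ : Measure Ω) [IsProbabilityMeasure κ], Integrable φ κ :=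
    fun κ _ => (integrable_const (1 : ℝ)).indicator hA
  have hint : ∀ κ : Measure Ω, ∫ x, φ x ∂κ = κ.real A := fun κ => integral_indicator_one hA
  set X : ℕ → Ω → ℝ := fun n x => (n : ℝ)⁻¹ * birkhoffSum T φ n x with hX
  have hXm : ∀ n, Measurable (X n) := fun n =>
    (measurable_birkhoffSum hT.measurable hφm n).const_mul _
  have hmeas : TendstoInMeasure μ X atTop fun _ => μ.real A := by
    refine tendstoInMeasure_of_tendsto_eLpNorm (p := 1) one_ne_zero
      (fun n => (hXm n).aestronglyMeasurable) aestronglyMeasurable_const ?_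
    have h1 : Tendsto (fun n => ENNReal.ofReal (∫ x, |X n x - μ.real A| ∂μ)) atTop (𝓝 0) := by
      rw [MeanErgodic, hint] at h
      simpa using ENNReal.tendsto_ofReal h
    refine h1.congr fun n => ?_
    have h2 : Integrable (fun x => X n x - μ.real A) μ :=
      ((integrable_birkhoffSum hT (hi μ) n).const_mul _).sub (integrable_const _)
    rw [eLpNorm_one_eq_lintegral_enorm]
    exact ofReal_integral_norm_eq_lintegral_enorm h2
  obtain ⟨ns, hns, hae⟩ := hmeas.exists_seq_tendsto_ae
  have hlim := tendsto_integral_of_dominated_convergence (μ := ν) (fun _ => (1 : ℝ))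
    (fun n => (hXm (ns n)).aestronglyMeasurable) (integrable_const _)
    (fun n => ae_of_all _ fun x => ?_) (hν.ae_le hae)
  · have hconst : ∀ n, 1 ≤ n → ∫ x, X n x ∂ν = ν.real A := by
      intro n hn
      have h3 : ∀ i, ∫ x, φ (T^[i] x) ∂ν = ν.real A := fun i => by
        rw [integral_comp_of_measurePreserving (hT'.iterate i) hφm.aestronglyMeasurable, hint]
      have hi' : ∀ i, Integrable (fun x => φ (T^[i] x)) ν := fun i =>
        ((hT'.iterate i).integrable_comp (hi ν).aestronglyMeasurable).2 (hi ν)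
      simp only [hX, birkhoffSum]
      rw [integral_const_mul, integral_finsetSum _ fun i _ => hi' i]
      have h4 : (n : ℝ) ≠ 0 := by positivity
      simp [h3, h4]
    have h5 : Tendsto (fun n => ∫ x, X (ns n) x ∂ν) atTop (𝓝 (ν.real A)) := by
      refine tendsto_const_nhds.congr' ?_
      filter_upwards [eventually_ge_atTop 1] with n hn
      exact (hconst _ (hn.trans (hns.id_le n))).symm
    have h6 := tendsto_nhds_unique h5 hlim
    simpa using h6
  · have h7 : birkhoffSum T φ (ns n) x ≤ ns n := by
      simpa [birkhoffSum] using Finset.sum_le_sum fun i (_ : i ∈ Finset.range (ns n)) =>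
        hφ1 (T^[i] x)
    have h8 : 0 ≤ birkhoffSum T φ (ns n) x := Finset.sum_nonneg fun i _ => hφ0 _
    rw [Real.norm_of_nonneg (by positivity)]
    simp only [hX]
    exact inv_mul_le_one_of_le₀ h7 (by positivity)

variable {γ : ℝ}

lemma meanErgodic_indicator_Iic (hγ : 0 < γ) (hγ' : γ < 1 / 2) (t : ℝ) :
    MeanErgodic (invMeasure γ) (Tmap γ) ((Set.Iic t).indicator fun _ => 1) := by
  have := isProbabilityMeasure_invMeasure hγ hγ'
  have hT := measurePreserving_invMeasure hγ hγ'
  have hF : Antitone ((Set.Iic t).indicator (fun _ => (1 : ℝ≥0∞))) := by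
    intro x y hxy
    by_cases hy : y ∈ Set.Iic t
    · have hx : x ∈ Set.Iic t := le_trans hxy hy
      rw [Set.indicator_of_mem hy, Set.indicator_of_mem hx]
    · rw [Set.indicator_of_notMem hy]; exact zero_le
  obtain ⟨m, h, hm, hh, hd, h2, hmh⟩ := exists_coboundary hγ hF (s := 0) (C := 1) le_rfl
    (by linarith) zero_le_one fun x _ => by
      simpa using Set.indicator_le_self' (fun _ _ => zero_le_one) x
  set φ : ℝ → ℝ := (Set.Iic t).indicator fun _ => 1 with hφ
  have e : ∀ x, ((Set.Iic t).indicator (fun _ => (1 : ℝ≥0∞)) x).toReal = φ x := by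
    intro x
    by_cases hx : x ∈ Set.Iic t <;> simp [hφ, hx]
  simp only [e] at hmh
  have hi : Integrable φ (invMeasure γ) := (integrable_const (1 : ℝ)).indicator measurableSet_Iic
  set c := ∫ y, φ y ∂invMeasure γ with hc
  have h1 : ∀ x, |φ x - c| ≤ 1 + |c| := fun x => (abs_sub _ _).trans (by
    gcongr
    by_cases hx : x ∈ Set.Iic t <;> simp [hφ, hx])
  have h3 : ∫ x, (φ x - c) ∂invMeasure γ = 0 := by
    rw [integral_sub hi (integrable_const _), ← hc]
    simp
  have h4 := hd.meanErgodic_of_coboundary hT hm h2 hh hmh h1 h3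
  have h5 := h4.add hT (hi.sub (integrable_const _)) (integrable_const c) (MeanErgodic.const c)
  simpa only [Pi.sub_apply, ← hc, sub_add_cancel] using h5

lemma meanErgodic_invMeasure (hγ : 0 < γ) (hγ' : γ < 1 / 2) {φ : ℝ → ℝ}
    (hφ : Integrable φ (invMeasure γ)) : MeanErgodic (invMeasure γ) (Tmap γ) φ := by
  have := isProbabilityMeasure_invMeasure hγ hγ'
  refine meanErgodic_of_isPiSystem (measurePreserving_invMeasure hγ hγ')
    ((BorelSpace.measurable_eq (α := ℝ)).trans (borel_eq_generateFrom_Iic ℝ)) isPiSystem_Iic ?_ hφ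
  rintro _ ⟨t, rfl⟩
  exact meanErgodic_indicator_Iic hγ hγ' t

lemma eq_invMeasure (hγ : 0 < γ) (hγ' : γ < 1 / 2) {ν : Measure ℝ} [IsProbabilityMeasure ν]
    (hν : MeasurePreserving (Tmap γ) ν ν) (hac : ν ≪ volume.restrict (Set.Icc (0 : ℝ) 1)) :
    ν = invMeasure γ := by
  have := isProbabilityMeasure_invMeasure hγ hγ'
  have hac' : ν ≪ invMeasure γ := by
    rw [Measure.restrict_congr_set Ioc_ae_eq_Icc.symm] at hac
    refine hac.trans (withDensity_absolutelyContinuous'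
      (antitone_invDensity hγ).measurable.aemeasurable ?_)
    exact (ae_restrict_mem measurableSet_Ioc).mono fun x hx => invDensity_ne_zero hγ hγ' hx
  refine Measure.ext_of_Iic _ _ fun t => ?_
  exact (measureReal_eq_measureReal_iff).1 ((meanErgodic_indicator_Iic hγ hγ' t).measureReal_eq
    (measurePreserving_invMeasure hγ hγ') hν hac' measurableSet_Iic)

end Uniqueness

/-! ### Tails and the central limit theorem for monotone observables -/

section Main

variable {γ : ℝ}

lemma measure_lt_le_of_density_le (hγ : γ < 1) {ν : Measure ℝ} {ρ f : ℝ → ℝ} {V C a t : ℝ}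
    (hν : ν = (volume.restrict (Set.Icc (0 : ℝ) 1)).withDensity fun x => ENNReal.ofReal (ρ x))
    (hρ : ∀ x ∈ Set.Ioo (0 : ℝ) 1, ρ x ≤ V * x ^ (-γ)) (hC : 0 < C) (ha : 0 < a) (ht : 0 < t)
    (hfm : Measurable f) (hfb : ∀ x ∈ Set.Ioo (0 : ℝ) 1, f x ≤ C * x ^ (-a)) :
    ν {x | t < f x} ≤
      ENNReal.ofReal (C ^ ((1 - γ) / a) * V / (1 - γ) * t ^ (-(1 - γ) / a)) := by
  set y : ℝ := (C / t) ^ (1 / a) with hy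
  have hy0 : 0 < y := by positivity
  have hsub : {x | t < f x} ∩ Set.Ioo 0 1 ⊆ Set.Ioc 0 y ∩ Set.Ioo 0 1 := by
    rintro x ⟨hx, hx'⟩
    refine ⟨⟨hx'.1, ?_⟩, hx'⟩
    have h1 : t < C * x ^ (-a) := lt_of_lt_of_le hx (hfb x hx')
    have hxa : 0 < x ^ a := Real.rpow_pos_of_pos hx'.1 a
    rw [Real.rpow_neg hx'.1.le, ← div_eq_mul_inv, lt_div_iff₀ hxa, mul_comm,
      ← lt_div_iff₀ ht] at h1
    calc x = (x ^ a) ^ (1 / a) := by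
          rw [← Real.rpow_mul hx'.1.le, mul_one_div_cancel ha.ne', Real.rpow_one]
      _ ≤ y := Real.rpow_le_rpow hxa.le h1.le (by positivity)
  have hpow : y ^ (1 - γ) = C ^ ((1 - γ) / a) * t ^ (-(1 - γ) / a) := by
    rw [hy, ← Real.rpow_mul (by positivity), Real.div_rpow hC.le ht.le, neg_div,
      Real.rpow_neg ht.le, div_eq_mul_inv, one_div_mul_eq_div]
  have hA : MeasurableSet {x | t < f x} := measurableSet_lt measurable_const hfm
  calc ν {x | t < f x}
      = ∫⁻ x in {x | t < f x} ∩ Set.Ioo 0 1, ENNReal.ofReal (ρ x) := by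
        rw [hν, withDensity_apply _ hA, Measure.restrict_restrict hA]
        exact setLIntegral_congr (ae_eq_set_inter (ae_eq_refl _) Ioo_ae_eq_Icc.symm)
    _ ≤ ∫⁻ x in {x | t < f x} ∩ Set.Ioo 0 1, ENNReal.ofReal (V * x ^ (-γ)) :=
        setLIntegral_mono' (hA.inter measurableSet_Ioo) fun x hx =>
          ENNReal.ofReal_le_ofReal (hρ x hx.2)
    _ ≤ ∫⁻ x in Set.Ioc 0 y, ENNReal.ofReal (V * x ^ (-γ)) :=
        lintegral_mono_set (hsub.trans Set.inter_subset_left)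
    _ = _ := by
        rw [setLIntegral_rpow hγ V hy0, hpow]
        congr 1
        ring

/-- The extension of an observable on `(0, 1)` by `∞` on the left and `0` on the right. -/
def extendIoo (f : ℝ → ℝ) (x : ℝ) : ℝ≥0∞ :=
  if x ≤ 0 then ∞ else if x < 1 then ENNReal.ofReal (f x) else 0

lemma extendIoo_of_mem (f : ℝ → ℝ) {x : ℝ} (hx : x ∈ Set.Ioo (0 : ℝ) 1) :
    extendIoo f x = ENNReal.ofReal (f x) := by
  simp [extendIoo, hx.1.not_ge, hx.2]

lemma antitone_extendIoo {f : ℝ → ℝ} (hf : AntitoneOn f (Set.Ioo (0 : ℝ) 1)) :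
    Antitone (extendIoo f) := by
  intro x y hxy
  rcases le_or_gt x 0 with hx | hx
  · simp [extendIoo, hx]
  rcases le_or_gt 1 y with hy | hy
  · simp [extendIoo, hy.not_gt, (hx.trans_le hxy).not_ge]
  have hx' : x ∈ Set.Ioo (0 : ℝ) 1 := ⟨hx, lt_of_le_of_lt hxy hy⟩
  have hy' : y ∈ Set.Ioo (0 : ℝ) 1 := ⟨lt_of_lt_of_le hx hxy, hy⟩
  rw [extendIoo_of_mem f hx', extendIoo_of_mem f hy']
  exact ENNReal.ofReal_le_ofReal (hf hx' hy' hxy)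

lemma extendIoo_le {f : ℝ → ℝ} {C a : ℝ} (hfb : ∀ x ∈ Set.Ioo (0 : ℝ) 1, f x ≤ C * x ^ (-a))
    {x : ℝ} (hx : x ∈ Set.Ioc (0 : ℝ) 1) : extendIoo f x ≤ ENNReal.ofReal (C * x ^ (-a)) := by
  rcases hx.2.lt_or_eq with h | h
  · rw [extendIoo_of_mem f ⟨hx.1, h⟩]
    exact ENNReal.ofReal_le_ofReal (hfb x ⟨hx.1, h⟩)
  · norm_num [extendIoo, h]

lemma ae_mem_Ioo_invMeasure (γ : ℝ) : ∀ᵐ x ∂invMeasure γ, x ∈ Set.Ioo (0 : ℝ) 1 := by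
  refine withDensity_absolutelyContinuous _ _ |>.ae_le ?_
  rw [Measure.restrict_congr_set Ioo_ae_eq_Ioc.symm]
  exact ae_restrict_mem measurableSet_Ioo

lemma Sn_eq_birkhoffSum (γ : ℝ) (f : ℝ → ℝ) (n : ℕ) (x : ℝ) :
    Sn γ f n x = birkhoffSum (Tmap γ) f n (Tmap γ x) := rfl

lemma birkhoffSum_ae_eq {Ω : Type*} [MeasurableSpace Ω] {μ : Measure Ω} {T : Ω → Ω}
    (hT : MeasurePreserving T μ μ) {φ ψ : Ω → ℝ} (h : φ =ᵐ[μ] ψ) (n : ℕ) :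
    birkhoffSum T φ n =ᵐ[μ] birkhoffSum T ψ n := by
  have h1 : ∀ᵐ x ∂μ, ∀ i, φ (T^[i] x) = ψ (T^[i] x) :=
    ae_all_iff.2 fun i => (hT.iterate i).quasiMeasurePreserving.ae h
  filter_upwards [h1] with x hx
  exact Finset.sum_congr rfl fun i _ => hx i

theorem tendsto_integral_Sn_invMeasure (hγ : 0 < γ) (hγ' : γ < 1 / 2) {f : ℝ → ℝ}
    (hfm : Measurable f) (hfpos : ∀ x ∈ Set.Ioo (0 : ℝ) 1, 0 < f x)
    (hfmono : AntitoneOn f (Set.Ioo (0 : ℝ) 1)) {C a : ℝ} (hC : 0 ≤ C) (ha : 0 ≤ a)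
    (ha' : a < 1 / 2 - γ) (hfb : ∀ x ∈ Set.Ioo (0 : ℝ) 1, f x ≤ C * x ^ (-a)) :
    ∃ v : ℝ≥0, ∀ g : BoundedContinuousFunction ℝ ℝ,
      Tendsto (fun n : ℕ => ∫ x, g ((n : ℝ) ^ (-(1 : ℝ) / 2) *
          Sn γ (fun z => f z - ∫ y, f y ∂invMeasure γ) n x) ∂invMeasure γ)
        atTop (𝓝 (∫ y, g y ∂gaussianReal 0 v)) := by
  have := isProbabilityMeasure_invMeasure hγ hγ'
  have hT := measurePreserving_invMeasure hγ hγ'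
  obtain ⟨m, h, hm, hh, hd, h2, hmh⟩ := exists_coboundary hγ (antitone_extendIoo hfmono) ha ha' hC
    fun x hx => extendIoo_le hfb hx
  obtain ⟨v, hv⟩ := hd.tendsto_integral_of_coboundary hT hm h2
    (fun φ hφ => meanErgodic_invMeasure hγ hγ' hφ) hh hmh
  refine ⟨v, fun g => (hv g).congr fun n => ?_⟩
  have hF : (fun x => (extendIoo f x).toReal) =ᵐ[invMeasure γ] f := by
    filter_upwards [ae_mem_Ioo_invMeasure γ] with x hx
    rw [extendIoo_of_mem f hx, ENNReal.toReal_ofReal (hfpos x hx).le]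
  set c := ∫ y, f y ∂invMeasure γ with hc
  have hF0 : (fun x => (extendIoo f x).toReal - ∫ y, (extendIoo f y).toReal ∂invMeasure γ)
      =ᵐ[invMeasure γ] fun x => f x - c := by
    filter_upwards [hF] with x hx
    rw [hx, integral_congr_ae hF]
  have hs : (n : ℝ) ^ (-(1 : ℝ) / 2) = (√n)⁻¹ := by
    rw [Real.sqrt_eq_rpow, neg_div, Real.rpow_neg n.cast_nonneg]
  have hmeas : Measurable fun x => g ((√n)⁻¹ * birkhoffSum (Tmap γ) (fun z => f z - c) n x) :=
    g.continuous.measurable.comp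
      ((measurable_birkhoffSum hT.measurable (hfm.sub_const c) n).const_mul _)
  rw [hs]
  simp only [Sn_eq_birkhoffSum]
  rw [integral_comp_of_measurePreserving hT
    (φ := fun x => g ((√n)⁻¹ * birkhoffSum (Tmap γ) (fun z => f z - c) n x))
    hmeas.aestronglyMeasurable]
  refine integral_congr_ae ?_
  filter_upwards [birkhoffSum_ae_eq hT hF0 n] with x hx
  rw [hx]

end Main

/-- first simple example: `γ ∈ (0,1/2)`, the density of `ν_γ`
is bounded by `V(γ) x^{−γ}`, and `f` is positive nonincreasing on `(0,1)` with
`f(x) ≤ C x^{−a}`, `0 ≤ a < 1/2 − γ`.  Then (for `a > 0`)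
`ν_γ(f > t) ≤ (C^{(1−γ)/a} V(γ)/(1−γ)) t^{−(1−γ)/a}` for all `t > 0`, and
`n^{-1/2} S_n(f − ν_γ(f))` converges in distribution to a centered Gaussian law. -/
theorem statement9 (γ : ℝ) (hγ : γ ∈ Set.Ioo (0:ℝ) (1/2))
    (ν : Measure ℝ) [IsProbabilityMeasure ν] (hsupp : ν (Set.Icc 0 1) = 1)
    (hinv : Measure.map (Tmap γ) ν = ν)
    (V : ℝ) (hV : 0 < V) (ρ : ℝ → ℝ)
    (hν : ν = (MeasureTheory.volume.restrict (Set.Icc (0:ℝ) 1)).withDensity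
        (fun x => ENNReal.ofReal (ρ x)))
    (hρ : ∀ x ∈ Set.Ioo (0:ℝ) 1, ρ x ≤ V * x ^ (-γ))
    (f : ℝ → ℝ) (hfm : Measurable f)
    (hfpos : ∀ x ∈ Set.Ioo (0:ℝ) 1, 0 < f x)
    (hfmono : AntitoneOn f (Set.Ioo (0:ℝ) 1))
    (C a : ℝ) (hC : 0 < C) (ha : 0 ≤ a) (ha' : a < 1/2 - γ)
    (hfb : ∀ x ∈ Set.Ioo (0:ℝ) 1, f x ≤ C * x ^ (-a)) :
    (0 < a → ∀ t : ℝ, 0 < t →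
      ν {x | t < f x} ≤ ENNReal.ofReal
        (C ^ ((1 - γ)/a) * V / (1 - γ) * t ^ (-(1 - γ)/a))) ∧
    ∃ v : ℝ≥0, ∀ g : BoundedContinuousFunction ℝ ℝ,
      Tendsto (fun n : ℕ => ∫ x, g ((n : ℝ) ^ (-(1:ℝ)/2) *
          Sn γ (fun z => f z - ∫ y, f y ∂ν) n x) ∂ν)
        atTop (𝓝 (∫ y, g y ∂(gaussianReal 0 v))) := by
  have hT : MeasurePreserving (Tmap γ) ν ν := ⟨measurable_Tmap, hinv⟩
  have hac : ν ≪ volume.restrict (Set.Icc (0 : ℝ) 1) :=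
    hν ▸ withDensity_absolutelyContinuous _ _
  refine ⟨fun ha0 t ht => measure_lt_le_of_density_le (by linarith [hγ.2]) hν hρ hC ha0 ht hfm hfb,
    ?_⟩
  rw [eq_invMeasure hγ.1 hγ.2 hT hac]
  exact tendsto_integral_Sn_invMeasure hγ.1 hγ.2 hfm hfpos hfmono hC.le ha ha' hfb

end
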